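/- arXiv:math/0605574 — 3 statements merged into one kernel-verified Lean document; each statement's English description precedes it below -/
import Mathlib

section
/- Assume R is not Gorenstein (equivalently, r ≥ 2). If there exists a finitely generated non-free R-module M such that Ext^{n+1}_R(M, R) = 0 for some n ≥ 2, then the Bass numbers of R satisfy: μ^0_R = r, μ^1_R = e·(r − 1), μ^2_R = e·μ^1_R − r² + 1, and μ^i_R = e·μ^{i−1}_R − r·μ^{i−2}_R for all 3 ≤ i ≤ n. (Equivalently, the Bass series of R agrees with (r − e·t + t²)/(1 − e·t + r·t²) in all degrees ≤ n.) -/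
open IsLocalRing CategoryTheory

/-- The length of an `R`-module `M`: the supremum of the lengths of strictly increasing
chains of submodules of `M`.  For a module annihilated by the maximal ideal of a local
ring this coincides with the dimension over the residue field `k`. -/
noncomputable def moduleLength (R M : Type) [Ring R] [AddCommGroup M] [Module R M] : ℕ∞ :=
  ⨆ p : LTSeries (Submodule R M), (p.length : ℕ∞)

/-- `Ext^n_R(M, N)`, as an object of `ModuleCat R`. -/
noncomputable def extModule (R : Type) [CommRing R] (M N : Type) [AddCommGroup M] [Module R M]
    [AddCommGroup N] [Module R N] (n : ℕ) : ModuleCat R :=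
  ((Ext R (ModuleCat R) n).obj (Opposite.op (ModuleCat.of R M))).obj (ModuleCat.of R N)

/-- The `i`-th Betti number `β_i^R(M) = dim_k Ext^i_R(M, k)` of a module `M` over a local
ring `(R, m, k)`, computed as the length over `R` of `Ext^i_R(M, k)` (an `R`-module
annihilated by `m`, hence a `k`-vector space). -/
noncomputable def bettiNum (R : Type) [CommRing R] [IsLocalRing R] (M : Type) [AddCommGroup M]
    [Module R M] (i : ℕ) : ℕ∞ :=
  moduleLength R (extModule R M (ResidueField R) i).carrier

/-- The `i`-th Bass number `μ^i_R = dim_k Ext^i_R(k, R)` of a local ring `(R, m, k)`. -/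
noncomputable def bassNum (R : Type) [CommRing R] [IsLocalRing R] (i : ℕ) : ℕ∞ :=
  moduleLength R (extModule R (ResidueField R) R i).carrier

/-- The socle `Soc R = (0 :_R m)` of a local ring `(R, m)`. -/
noncomputable def socle (R : Type) [CommRing R] [IsLocalRing R] : Ideal R :=
  Submodule.colon (⊥ : Ideal R) (maximalIdeal R)

/-- The socle dimension `r = dim_k (0 :_R m)` of a local ring `(R, m, k)`. -/
noncomputable def socdim (R : Type) [CommRing R] [IsLocalRing R] : ℕ∞ :=
  moduleLength R (socle R)

/-- The embedding dimension `e = dim_k (m/m²)` of a local ring `(R, m, k)`. -/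
noncomputable def embdim (R : Type) [CommRing R] [IsLocalRing R] : ℕ∞ :=
  moduleLength R (CotangentSpace R)

/-- The residue field `k` is (isomorphic to) a direct summand of the `R`-module `M`,
expressed by a split injection `k → M`. -/
def kSummand (R : Type) [CommRing R] [IsLocalRing R] (M : Type) [AddCommGroup M]
    [Module R M] : Prop :=
  ∃ (f : M →ₗ[R] ResidueField R) (g : ResidueField R →ₗ[R] M), f ∘ₗ g = LinearMap.id


lemma moduleLength_eq (R M : Type) [Ring R] [AddCommGroup M] [Module R M] :
    moduleLength R M = Module.length R M := by
  apply WithBot.coe_injective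
  rw [Module.coe_length, Order.krullDim_eq_iSup_length]
  simp only [moduleLength]

section Bridge

variable {R : Type} [CommRing R] {X Y : ModuleCat.{0} R} (P : ProjectiveResolution X)

lemma smul_extMk {n : ℕ} (r : R) (f : P.complex.X n ⟶ Y) (m : ℕ) (hm : n + 1 = m)
    (hf : P.complex.d m n ≫ f = 0) (hf' : P.complex.d m n ≫ (r • f) = 0) :
    P.extMk (r • f) m hm hf' = r • P.extMk f m hm hf := by
  rw [Abelian.Ext.smul_eq_comp_mk₀, ProjectiveResolution.extMk_comp_mk₀]
  congr 1

lemma exists_equiv_succ (X Y : ModuleCat.{0} R) (q : ℕ) :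
    Nonempty ((((_root_.Ext R (ModuleCat R) (q + 1)).obj (Opposite.op X)).obj Y) ≃ₗ[R]
      Abelian.Ext X Y (q + 1)) := by
  let P := projectiveResolution X
  let K := P.complex.linearYonedaObj R Y
  let S := K.sc' q (q + 1) (q + 2)
  have e1 : (((_root_.Ext R (ModuleCat R) (q + 1)).obj (Opposite.op X)).obj Y) ≅
      S.moduleCatLeftHomologyData.H :=
    P.isoExt (q + 1) Y ≪≫
      ShortComplex.homologyMapIso (K.isoSc' q (q + 1) (q + 2) (by simp) (by simp)) ≪≫
      S.moduleCatHomologyIso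
  let φ : LinearMap.ker S.g.hom →ₗ[R] Abelian.Ext X Y (q + 1) :=
    { toFun := fun f => P.extMk (n := q + 1) (f.1 : P.complex.X (q + 1) ⟶ Y) (q + 2) rfl f.2
      map_add' := fun f g => (P.add_extMk _ _ _ _ _ _).symm
      map_smul' := fun r f => smul_extMk P r _ _ _ _ _ }
  have hφ : Function.Surjective φ := by
    intro α
    obtain ⟨f, hf, h⟩ := P.extMk_surjective α (q + 2) rfl
    exact ⟨⟨f, hf⟩, h⟩
  have hk : LinearMap.range S.moduleCatToCycles = LinearMap.ker φ := by
    ext f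
    rw [LinearMap.mem_ker]
    refine Iff.trans ?_ (P.extMk_eq_zero_iff _ (q + 2) rfl f.2 q rfl).symm
    constructor
    · rintro ⟨g, hg⟩
      exact ⟨g, congrArg Subtype.val hg⟩
    · rintro ⟨g, hg⟩
      exact ⟨g, Subtype.ext hg⟩
  exact ⟨e1.toLinearEquiv ≪≫ₗ Submodule.quotEquivOfEq _ _ hk ≪≫ₗ
    φ.quotKerEquivOfSurjective hφ⟩

lemma exists_equiv_zero (X Y : ModuleCat.{0} R) :
    Nonempty ((((_root_.Ext R (ModuleCat R) 0).obj (Opposite.op X)).obj Y) ≃ₗ[R]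
      Abelian.Ext X Y 0) := by
  have : Limits.PreservesFiniteColimits ((linearYoneda R (ModuleCat R)).obj Y).rightOp := by
    have h1 : Limits.PreservesLimits (((linearYoneda R (ModuleCat R)).obj Y) ⋙ forget _) :=
      inferInstanceAs (Limits.PreservesLimits (yoneda.obj Y))
    have h2 : Limits.PreservesLimits ((linearYoneda R (ModuleCat R)).obj Y) :=
      Limits.preservesLimits_of_reflects_of_preserves _ (forget _)
    have h3 : Limits.PreservesFiniteLimits ((linearYoneda R (ModuleCat R)).obj Y) := by
      infer_instance
    exact Limits.preservesFiniteColimits_rightOp _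
  have e := (((linearYoneda R (ModuleCat R)).obj Y).rightOp.leftDerivedZeroIsoSelf.app X).unop
  exact ⟨e.toLinearEquiv.symm ≪≫ₗ Abelian.Ext.linearEquiv₀.symm⟩

lemma exists_equiv (X Y : ModuleCat.{0} R) : (q : ℕ) →
    Nonempty ((((_root_.Ext R (ModuleCat R) q).obj (Opposite.op X)).obj Y) ≃ₗ[R]
      Abelian.Ext X Y q)
  | 0 => exists_equiv_zero X Y
  | q + 1 => exists_equiv_succ X Y q

end Bridge

section Local

variable {R : Type} [CommRing R] [IsLocalRing R]

lemma smul_residue_eq_zero {a : R} (ha : a ∈ maximalIdeal R) (x : ResidueField R) : a • x = 0 := by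
  have : residue R a = 0 := (residue_eq_zero_iff a).2 ha
  rw [Algebra.smul_def, ResidueField.algebraMap_eq, this, zero_mul]

lemma exists_functional {C : Type} [AddCommGroup C] [Module R C] (x : C)
    (hx : x ∉ (maximalIdeal R • ⊤ : Submodule R C)) :
    ∃ g : C →ₗ[R] ResidueField R, g x = 1 := by
  let : Module (ResidueField R) (C ⧸ (maximalIdeal R • ⊤ : Submodule R C)) :=
    (inferInstance : Module (R ⧸ maximalIdeal R) (C ⧸ (maximalIdeal R • ⊤ : Submodule R C)))
  have : IsScalarTower R (ResidueField R) (C ⧸ (maximalIdeal R • ⊤ : Submodule R C)) :=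
    (inferInstance : IsScalarTower R (R ⧸ maximalIdeal R)
      (C ⧸ (maximalIdeal R • ⊤ : Submodule R C)))
  have hx' : (Submodule.Quotient.mk x : C ⧸ (maximalIdeal R • ⊤ : Submodule R C)) ≠ 0 := by
    rwa [Ne, Submodule.Quotient.mk_eq_zero]
  obtain ⟨f, hf⟩ : ∃ f : Module.Dual (ResidueField R)
      (C ⧸ (maximalIdeal R • ⊤ : Submodule R C)), f (Submodule.Quotient.mk x) ≠ 0 := by
    by_contra! h
    exact hx' ((Module.forall_dual_apply_eq_zero_iff (ResidueField R) _).1 h)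
  refine ⟨((f (Submodule.Quotient.mk x))⁻¹ • f).restrictScalars R ∘ₗ Submodule.mkQ _, ?_⟩
  simp [hf]

lemma eq_bot_of_forall_functional {C : Type} [AddCommGroup C] [Module R C] [Module.Finite R C]
    (h : ∀ g : C →ₗ[R] ResidueField R, g = 0) : Subsingleton C := by
  have h1 : (⊤ : Submodule R C) ≤ maximalIdeal R • ⊤ := by
    intro x _
    by_contra hx
    obtain ⟨g, hg⟩ := exists_functional x hx
    rw [h g] at hg
    simp at hg
  have h2 := Submodule.eq_bot_of_le_smul_of_le_jacobson_bot _ _ Module.Finite.fg_top h1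
    (by rw [IsLocalRing.jacobson_eq_maximalIdeal _ bot_ne_top])
  exact (Submodule.subsingleton_iff R).1 (subsingleton_of_bot_eq_top h2.symm)

lemma exists_min_cover (M : Type) [AddCommGroup M] [Module R M] [Module.Finite R M] :
    ∃ (d : ℕ) (f : (Fin d → R) →ₗ[R] M), Function.Surjective f ∧
      ∀ x, f x = 0 → ∀ i, x i ∈ maximalIdeal R := by
  let w := Module.finBasis (ResidueField R) (TensorProduct R (ResidueField R) M)
  obtain ⟨v, eq⟩ := (TensorProduct.mk_surjective R M (ResidueField R)
    Ideal.Quotient.mk_surjective).comp_left w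
  refine ⟨_, Fintype.linearCombination R v, ?_, ?_⟩
  · rw [← LinearMap.range_eq_top, Fintype.range_linearCombination]
    exact span_eq_top_of_tmul_eq_basis _ w (congr_fun eq)
  · intro x hx i
    have h1 : TensorProduct.mk R (ResidueField R) M 1 (Fintype.linearCombination R v x) = 0 := by
      rw [hx, map_zero]
    rw [Fintype.linearCombination_apply, map_sum] at h1
    have h2 : ∑ i, (residue R (x i)) • w i = 0 := by
      rw [← h1]
      refine Finset.sum_congr rfl fun i _ => ?_
      rw [map_smul, ← congr_fun eq i]
      exact algebraMap_smul (ResidueField R) (x i) _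
    rw [← residue_eq_zero_iff]
    exact Fintype.linearIndependent_iff.1 w.linearIndependent _ h2 i

lemma free_of_ext [IsNoetherianRing R] (s : R) (hs : s ≠ 0)
    (hs' : ∀ a ∈ maximalIdeal R, a * s = 0) (j : ℕ) :
    ∀ (M : Type) [AddCommGroup M] [Module R M] [Module.Finite R M],
      Subsingleton (Abelian.Ext (ModuleCat.of R M) (ModuleCat.of R (ResidueField R)) (j + 1)) →
      Module.Free R M := by
  induction j with
  | zero =>
    intro M _ _ _ hM
    obtain ⟨d, f, hf, hK⟩ := exists_min_cover (R := R) M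
    have hS := LinearMap.shortExact_shortComplexKer hf
    have : Subsingleton (LinearMap.ker f) := by
      refine eq_bot_of_forall_functional (R := R) fun g => ?_
      obtain ⟨β, hβ⟩ := Abelian.Ext.contravariant_sequence_exact₁ hS
        (ModuleCat.of R (ResidueField R)) (Abelian.Ext.mk₀ (ModuleCat.ofHom g)) (n₁ := 0 + 1) rfl
        (Subsingleton.elim _ _)
      obtain ⟨ψ, rfl⟩ := Abelian.Ext.mk₀_bijective _ _ |>.2 β
      rw [Abelian.Ext.mk₀_comp_mk₀] at hβ
      have h1 := (Abelian.Ext.mk₀_bijective _ _).1 hβ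
      ext ⟨x, hx⟩
      have h2 : g ⟨x, hx⟩ = ψ.hom x := by
        rw [← ModuleCat.hom_ofHom g, ← h1]; rfl
      rw [h2]
      change ψ.hom (x : Fin d → R) = 0
      rw [LinearMap.pi_apply_eq_sum_univ ψ.hom x]
      exact Finset.sum_eq_zero fun i _ => smul_residue_eq_zero (hK x hx i) _
    have hi : Function.Injective f := by
      rw [← LinearMap.ker_eq_bot]; exact Submodule.eq_bot_of_subsingleton
    exact Module.Free.of_equiv (LinearEquiv.ofBijective f ⟨hi, hf⟩)
  | succ j ih =>
    intro M _ _ _ hM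
    obtain ⟨d, f, hf, hK⟩ := exists_min_cover (R := R) M
    have hS := LinearMap.shortExact_shortComplexKer hf
    have hfree : Module.Free R (LinearMap.ker f) := by
      refine ih _ ⟨fun a b => ?_⟩
      have hz : ∀ a : Abelian.Ext (ModuleCat.of R (LinearMap.ker f))
          (ModuleCat.of R (ResidueField R)) (j + 1), a = 0 := by
        intro a
        obtain ⟨β, hβ⟩ := Abelian.Ext.contravariant_sequence_exact₁ hS
          (ModuleCat.of R (ResidueField R)) a (n₁ := j + 1 + 1) (by omega)
          (Subsingleton.elim _ _)
        have : Projective f.shortComplexKer.X₂ :=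
          (IsProjective.iff_projective (R := R) (Fin d → R)).1 inferInstance
        rw [← hβ, Abelian.Ext.eq_zero_of_projective β, Abelian.Ext.comp_zero]
      rw [hz a, hz b]
    have hsK : ∀ x : LinearMap.ker f, s • x = 0 := by
      rintro ⟨x, hx⟩
      ext i
      change s * x i = 0
      rw [mul_comm]
      exact hs' _ (hK x hx i)
    have : Subsingleton (LinearMap.ker f) := by
      by_contra hn
      rw [not_subsingleton_iff_nontrivial] at hn
      have b := Module.Free.chooseBasis R (LinearMap.ker f)
      obtain ⟨i⟩ := b.index_nonempty
      have h1 := congrArg (fun y => b.repr y i) (hsK (b i))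
      simp at h1
      exact hs h1
    have hi : Function.Injective f := by
      rw [← LinearMap.ker_eq_bot]; exact Submodule.eq_bot_of_subsingleton
    exact Module.Free.of_equiv (LinearEquiv.ofBijective f ⟨hi, hf⟩)

end Local

section Cosyzygy

variable {R : Type} [CommRing R]

lemma exists_inj_ses (Y : ModuleCat.{0} R) :
    ∃ (I Z : ModuleCat.{0} R) (f : Y ⟶ I) (g : I ⟶ Z) (w : f ≫ g = 0),
      (ShortComplex.mk f g w).ShortExact ∧ Injective I := by
  refine ⟨Injective.under Y, Limits.cokernel (Injective.ι Y), Injective.ι Y,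
    Limits.cokernel.π _, Limits.cokernel.condition _, ?_, inferInstance⟩
  exact { exact := ShortComplex.exact_cokernel _, mono_f := inferInstanceAs (Mono (Injective.ι Y)),
          epi_g := inferInstanceAs (Epi (Limits.cokernel.π _)) }

lemma exists_cosyzygy (Y : ModuleCat.{0} R) (i : ℕ) :
    ∃ (Z : ModuleCat.{0} R) (ξ : Abelian.Ext Z Y i),
      (∀ (X : ModuleCat.{0} R) (a b : ℕ) (h : a + i = b) (γ : Abelian.Ext X Y b),
        ∃ δ : Abelian.Ext X Z a, δ.comp ξ h = γ) ∧
      (∀ (X : ModuleCat.{0} R) (a b : ℕ) (h : (a + 1) + i = b) (δ : Abelian.Ext X Z (a + 1)),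
        δ.comp ξ h = 0 → δ = 0) := by
  induction i with
  | zero =>
    refine ⟨Y, Abelian.Ext.mk₀ (𝟙 Y), ?_, ?_⟩
    · rintro X a b rfl γ
      exact ⟨γ, Abelian.Ext.comp_mk₀_id γ⟩
    · rintro X a b rfl δ h
      rwa [Abelian.Ext.comp_mk₀_id] at h
  | succ i ih =>
    obtain ⟨Z, ξ, h1, h2⟩ := ih
    obtain ⟨I, Z', f, g, w, hS, hI⟩ := exists_inj_ses Z
    refine ⟨Z', hS.extClass.comp ξ (add_comm 1 i), ?_, ?_⟩
    · rintro X a b h γ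
      obtain ⟨δ, rfl⟩ := h1 X (a + 1) b (by omega) γ
      obtain ⟨ε, rfl⟩ := Abelian.Ext.covariant_sequence_exact₁ X hS δ
        (Abelian.Ext.eq_zero_of_injective (I := I) _) rfl
      exact ⟨ε, (Abelian.Ext.comp_assoc ε hS.extClass ξ rfl (add_comm 1 i) (by omega)).symm⟩
    · rintro X a b h δ hδ
      rw [← Abelian.Ext.comp_assoc δ hS.extClass ξ rfl (add_comm 1 i) (by omega)] at hδ
      have h3 := h2 X (a + 1) b (by omega) _ hδ
      obtain ⟨ε, rfl⟩ := Abelian.Ext.covariant_sequence_exact₃ X hS δ rfl h3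
      rw [Abelian.Ext.eq_zero_of_injective (I := I) ε, Abelian.Ext.zero_comp]

end Cosyzygy

section LemmaB

variable {R : Type} [CommRing R] [IsLocalRing R]

lemma mem_socle_iff (s : R) : s ∈ socle R ↔ ∀ a ∈ maximalIdeal R, a * s = 0 := by
  simp only [socle, Submodule.mem_colon, Submodule.mem_bot, smul_eq_mul]
  constructor
  · intro h a ha
    rw [mul_comm]; exact h a ha
  · intro h a ha
    rw [mul_comm]; exact h a ha

lemma socle_smul {C : Type} [AddCommGroup C] [Module R C] (y : C)
    (hy : y ∈ (maximalIdeal R • ⊤ : Submodule R C)) (s : R) (hs : s ∈ socle R) : s • y = 0 := by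
  refine Submodule.smul_induction_on hy ?_ ?_
  · intro a ha c _
    rw [smul_smul, mul_comm, (mem_socle_iff s).1 hs a ha, zero_smul]
  · intro x y hx hy
    rw [smul_add, hx, hy, add_zero]

/-- The projection `R/S → k`. -/
noncomputable def toK (h : socle R ≤ maximalIdeal R) : (R ⧸ socle R) →ₗ[R] ResidueField R :=
  Submodule.liftQ _ (Algebra.linearMap R (ResidueField R)) (by
    intro s hs
    rw [LinearMap.mem_ker, Algebra.linearMap_apply, ResidueField.algebraMap_eq,
      residue_eq_zero_iff]
    exact h hs)

lemma lemmaB [IsNoetherianRing R] (h : socle R ≤ maximalIdeal R) (s : R) (hs : s ≠ 0)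
    (hs' : s ∈ socle R) (n : ℕ) (M : Type) [AddCommGroup M] [Module R M] [Module.Finite R M]
    (hM : ¬ Module.Free R M)
    (hext : Subsingleton (Abelian.Ext (ModuleCat.of R M) (ModuleCat.of R R) (n + 1)))
    (i : ℕ) (hi : i + 1 ≤ n)
    (α : Abelian.Ext (ModuleCat.of R (ResidueField R)) (ModuleCat.of R R) (i + 1)) :
    (Abelian.Ext.mk₀ (ModuleCat.ofHom (toK h))).comp α (zero_add _) = 0 := by
  obtain ⟨Z, ξ, h1, h2⟩ := exists_cosyzygy (ModuleCat.of R R) i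
  obtain ⟨I, Z', f, g, w, hS, hI⟩ := exists_inj_ses Z
  obtain ⟨δ, rfl⟩ := h1 _ (0 + 1) _ (by omega) α
  obtain ⟨ε, rfl⟩ := Abelian.Ext.covariant_sequence_exact₁ _ hS δ
        (Abelian.Ext.eq_zero_of_injective (I := I) _) rfl
  obtain ⟨φ, rfl⟩ := (Abelian.Ext.mk₀_bijective _ _).2 ε
  have hgs : Function.Surjective g.hom := hS.moduleCat_surjective_g
  by_cases hφ : φ.hom (1 : ResidueField R) ∈ (maximalIdeal R • ⊤ : Submodule R Z')
  · have hy : ∃ y ∈ (maximalIdeal R • ⊤ : Submodule R I), g.hom y = φ.hom (1 : ResidueField R) := by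
      have : (maximalIdeal R • ⊤ : Submodule R I).map g.hom = maximalIdeal R • ⊤ := by
        rw [Submodule.map_smul'', Submodule.map_top, LinearMap.range_eq_top.2 hgs]
      rw [← this] at hφ
      exact hφ
    obtain ⟨y, hy, hgy⟩ := hy
    let ψ : (R ⧸ socle R) →ₗ[R] I := Submodule.liftQ _ (LinearMap.toSpanSingleton R I y) (by
      intro s hs
      rw [LinearMap.mem_ker, LinearMap.toSpanSingleton_apply]
      exact socle_smul y hy s hs)
    have hcomp : ModuleCat.ofHom (toK h) ≫ φ = ModuleCat.ofHom ψ ≫ g := by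
      ext
      change φ.hom (toK h (Submodule.Quotient.mk 1)) = g.hom (ψ (Submodule.Quotient.mk 1))
      simp only [ψ, toK]
      rw [Submodule.liftQ_apply, Submodule.liftQ_apply]
      simp [hgy]
    rw [← Abelian.Ext.comp_assoc _ _ ξ (zero_add _) (by omega) (by omega)]
    rw [Abelian.Ext.mk₀_comp_mk₀_assoc, hcomp, ← Abelian.Ext.mk₀_comp_mk₀_assoc]
    have := hS.comp_extClass
    dsimp only at this
    rw [this, Abelian.Ext.comp_zero, Abelian.Ext.zero_comp]
  · exfalso
    obtain ⟨q, hq⟩ := exists_functional _ hφ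
    apply hM
    obtain ⟨a, ha⟩ : ∃ a, a + 1 + (i + 1) = n + 1 := ⟨n - i - 1, by omega⟩
    refine free_of_ext s hs ((mem_socle_iff s).1 hs') a M ⟨fun x y => ?_⟩
    have key : ∀ x : Abelian.Ext (ModuleCat.of R M) (ModuleCat.of R (ResidueField R)) (a + 1),
        x = 0 := by
      intro x
      have e1 : ((x.comp (Abelian.Ext.mk₀ φ) (add_zero _)).comp hS.extClass rfl).comp ξ
          (show a + 1 + 1 + i = n + 1 by omega) = 0 := Subsingleton.elim _ _
      have e2 := h2 _ _ _ _ _ e1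
      obtain ⟨ε, hε⟩ := Abelian.Ext.covariant_sequence_exact₃ _ hS _ rfl e2
      rw [Abelian.Ext.eq_zero_of_injective (I := I) ε, Abelian.Ext.zero_comp] at hε
      have e3 : φ ≫ ModuleCat.ofHom q = 𝟙 _ := by
        ext x
        obtain ⟨c, rfl⟩ := residue_surjective (R := R) x
        have hc : residue R c = c • (1 : ResidueField R) := by
          rw [Algebra.smul_def, ResidueField.algebraMap_eq, mul_one]
        change q (φ.hom (residue R c)) = residue R c
        rw [hc, map_smul, map_smul, hq]
      have e4 : (x.comp (Abelian.Ext.mk₀ φ) (add_zero _)).comp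
          (Abelian.Ext.mk₀ (ModuleCat.ofHom q)) (add_zero _) = x := by
        rw [Abelian.Ext.comp_assoc x (Abelian.Ext.mk₀ φ) (Abelian.Ext.mk₀ (ModuleCat.ofHom q))
          (add_zero _) (add_zero _) (by omega),
          Abelian.Ext.mk₀_comp_mk₀, e3, Abelian.Ext.comp_mk₀_id]
      rw [← e4, ← hε, Abelian.Ext.zero_comp]
    rw [key x, key y]

end LemmaB

section Restriction

variable {R : Type} [CommRing R] [IsLocalRing R]

/-- `0 → m → R → k → 0`. -/
noncomputable abbrev sesM (R : Type) [CommRing R] [IsLocalRing R] : ShortComplex (ModuleCat.{0} R) :=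
  ShortComplex.mk (ModuleCat.ofHom (maximalIdeal R).subtype)
    (ModuleCat.ofHom (Algebra.linearMap R (ResidueField R))) (by
      ext x
      exact (residue_eq_zero_iff x.1).2 x.2)

lemma sesM_shortExact : (sesM R).ShortExact := by
  refine ModuleCat.shortComplex_shortExact _ ?_ (Submodule.injective_subtype _)
    (by exact residue_surjective (R := R))
  intro x
  constructor
  · intro h
    exact ⟨⟨x, (residue_eq_zero_iff (R := R) x).1 h⟩, rfl⟩
  · rintro ⟨y, rfl⟩
    exact (residue_eq_zero_iff y.1).2 y.2

/-- `0 → S → R → R/S → 0`. -/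
noncomputable abbrev sesS (R : Type) [CommRing R] [IsLocalRing R] : ShortComplex (ModuleCat.{0} R) :=
  ShortComplex.mk (ModuleCat.ofHom (socle R).subtype)
    (ModuleCat.ofHom (Submodule.mkQ (socle R))) (by
      ext x
      exact (Submodule.Quotient.mk_eq_zero _).2 x.2)

lemma sesS_shortExact : (sesS R).ShortExact := by
  refine ModuleCat.shortComplex_shortExact _ ?_ (Submodule.injective_subtype _)
    (Submodule.mkQ_surjective (socle R))
  intro x
  constructor
  · intro h
    exact ⟨⟨x, (Submodule.Quotient.mk_eq_zero (socle R)).1 h⟩, rfl⟩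
  · rintro ⟨y, rfl⟩
    exact (Submodule.Quotient.mk_eq_zero _).2 y.2

/-- the morphism of short exact sequences -/
noncomputable abbrev sesSM (h : socle R ≤ maximalIdeal R) : sesS R ⟶ sesM R where
  τ₁ := ModuleCat.ofHom (Submodule.inclusion h)
  τ₂ := 𝟙 _
  τ₃ := ModuleCat.ofHom (toK h)
  comm₁₂ := by ext; rfl
  comm₂₃ := by ext; rfl

lemma natural_aux {S₁ S₂ : ShortComplex (ModuleCat.{0} R)} (h₁ : S₁.ShortExact)
    (h₂ : S₂.ShortExact) (f : S₁ ⟶ S₂) (Y : ModuleCat.{0} R) {i j : ℕ}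
    (α : Abelian.Ext S₂.X₁ Y i) (hj : 1 + i = j)
    (h : (Abelian.Ext.mk₀ f.τ₃).comp (h₂.extClass.comp α hj) (zero_add _) = 0) :
    h₁.extClass.comp ((Abelian.Ext.mk₀ f.τ₁).comp α (zero_add _)) hj = 0 := by
  rw [← Abelian.Ext.comp_assoc _ _ α (add_zero _) (zero_add _) (by omega),
    ShortComplex.ShortExact.extClass_naturality h₁ h₂ f,
    Abelian.Ext.comp_assoc _ _ α (zero_add _) hj (by omega), h]

lemma restriction (h : socle R ≤ maximalIdeal R) (i : ℕ)
    (α : Abelian.Ext (ModuleCat.of R (maximalIdeal R)) (ModuleCat.of R R) i)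
    (hB : ∀ α : Abelian.Ext (ModuleCat.of R (ResidueField R)) (ModuleCat.of R R) (i + 1),
      (Abelian.Ext.mk₀ (ModuleCat.ofHom (toK h))).comp α (zero_add _) = 0) :
    ∃ β : Abelian.Ext (ModuleCat.of R R) (ModuleCat.of R R) i,
      (Abelian.Ext.mk₀ (ModuleCat.ofHom (Submodule.inclusion h))).comp α (zero_add _) =
      (Abelian.Ext.mk₀ (ModuleCat.ofHom (socle R).subtype)).comp β (zero_add _) := by
  have h1 : (sesS_shortExact (R := R)).extClass.comp
      ((Abelian.Ext.mk₀ (ModuleCat.ofHom (Submodule.inclusion h))).comp α (zero_add _))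
      (add_comm 1 i) = 0 := by
    exact natural_aux _ sesM_shortExact (sesSM h) _ α _ (hB _)
  obtain ⟨β, hβ⟩ := Abelian.Ext.contravariant_sequence_exact₁ sesS_shortExact _ _ _ h1
  exact ⟨β, hβ.symm⟩

lemma restriction_pos (h : socle R ≤ maximalIdeal R) (i : ℕ)
    (α : Abelian.Ext (ModuleCat.of R (maximalIdeal R)) (ModuleCat.of R R) (i + 1))
    (hB : ∀ α : Abelian.Ext (ModuleCat.of R (ResidueField R)) (ModuleCat.of R R) (i + 1 + 1),
      (Abelian.Ext.mk₀ (ModuleCat.ofHom (toK h))).comp α (zero_add _) = 0) :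
    (Abelian.Ext.mk₀ (ModuleCat.ofHom (Submodule.inclusion h))).comp α (zero_add _) = 0 := by
  obtain ⟨β, hβ⟩ := restriction h (i + 1) α hB
  have : Projective (ModuleCat.of R R) :=
    (IsProjective.iff_projective (R := R) R).1 inferInstance
  rw [hβ, Abelian.Ext.eq_zero_of_projective β, Abelian.Ext.comp_zero]

lemma restriction_zero (h : socle R ≤ maximalIdeal R)
    (hB : ∀ α : Abelian.Ext (ModuleCat.of R (ResidueField R)) (ModuleCat.of R R) (0 + 1),
      (Abelian.Ext.mk₀ (ModuleCat.ofHom (toK h))).comp α (zero_add _) = 0)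
    (φ : maximalIdeal R →ₗ[R] R) :
    ∃ a : R, ∀ s (hs : s ∈ socle R), φ ⟨s, h hs⟩ = a * s := by
  obtain ⟨β, hβ⟩ := restriction h 0 (Abelian.Ext.mk₀ (ModuleCat.ofHom φ)) hB
  obtain ⟨ψ, rfl⟩ := (Abelian.Ext.mk₀_bijective _ _).2 β
  rw [Abelian.Ext.mk₀_comp_mk₀, Abelian.Ext.mk₀_comp_mk₀] at hβ
  have h1 := (Abelian.Ext.mk₀_bijective _ _).1 hβ
  refine ⟨ψ.hom (1 : R), fun s hs => ?_⟩
  have h2 := congrArg (fun f => f.hom ⟨s, hs⟩) h1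
  refine h2.trans ?_
  change ψ.hom (s : R) = _
  have : ψ.hom ((s : R) • (1 : R)) = s • (ψ.hom (1 : R) : R) := map_smul _ _ _
  rw [smul_eq_mul, mul_one] at this
  rw [this, smul_eq_mul, mul_comm]

lemma socle_le (h2 : maximalIdeal R ^ 2 ≠ ⊥) : socle R ≤ maximalIdeal R := by
  intro s hs
  by_contra hn
  have hu : IsUnit s := by
    by_contra h; exact hn ((mem_maximalIdeal s).2 h)
  apply h2
  rw [eq_bot_iff, pow_two, Ideal.mul_le]
  intro a ha b hb
  have := (mem_socle_iff s).1 hs a ha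
  rw [hu.mul_left_eq_zero] at this
  simp [this]

lemma sq_le_socle (h3 : maximalIdeal R ^ 3 = ⊥) : maximalIdeal R ^ 2 ≤ socle R := by
  intro s hs
  rw [mem_socle_iff]
  intro a ha
  have : a * s ∈ maximalIdeal R ^ 3 := by
    rw [pow_succ']; exact Ideal.mul_mem_mul ha hs
  rwa [h3] at this

lemma length_le_one (s : R) (hs : ∀ t ∈ socle R, ∃ a : R, t = a * s) (hs' : s ∈ socle R) :
    Module.length R (socle R) ≤ 1 := by
  have hk : ∀ x ∈ maximalIdeal R, x ∈ LinearMap.ker (LinearMap.toSpanSingleton R (socle R) ⟨s, hs'⟩) := by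
    intro x hx
    rw [LinearMap.mem_ker, LinearMap.toSpanSingleton_apply]
    exact Subtype.ext ((mem_socle_iff s).1 hs' x hx)
  let f : (R ⧸ maximalIdeal R) →ₗ[R] socle R := Submodule.liftQ _ _ hk
  have hf : Function.Surjective f := by
    rintro ⟨t, ht⟩
    obtain ⟨a, rfl⟩ := hs t ht
    exact ⟨Submodule.Quotient.mk a, rfl⟩
  have : IsSimpleModule R (R ⧸ maximalIdeal R) := by
    rw [isSimpleModule_iff_isCoatom]
    exact (IsLocalRing.maximalIdeal.isMaximal R).out
  refine (Module.length_le_of_surjective f hf).trans ?_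
  rw [Module.length_eq_one]

lemma socle_eq (h3 : maximalIdeal R ^ 3 = ⊥) (h : socle R ≤ maximalIdeal R)
    (hnotGor : 2 ≤ socdim R)
    (hB : ∀ α : Abelian.Ext (ModuleCat.of R (ResidueField R)) (ModuleCat.of R R) (0 + 1),
      (Abelian.Ext.mk₀ (ModuleCat.ofHom (toK h))).comp α (zero_add _) = 0) :
    socle R = maximalIdeal R ^ 2 := by
  refine le_antisymm ?_ (sq_le_socle h3)
  intro s hs
  by_contra hn
  have hx : (⟨s, h hs⟩ : maximalIdeal R) ∉ (maximalIdeal R • ⊤ : Submodule R (maximalIdeal R)) := by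
    intro hx
    apply hn
    have := Submodule.mem_map_of_mem (f := (maximalIdeal R).subtype) hx
    rw [Submodule.map_smul'', Submodule.map_top, Submodule.range_subtype] at this
    rw [pow_two]
    exact this
  obtain ⟨g, hg⟩ := exists_functional _ hx
  have : Module.length R (socle R) ≤ 1 := by
    refine length_le_one s (fun t ht => ?_) hs
    have hk : ∀ x ∈ maximalIdeal R, x ∈ LinearMap.ker (LinearMap.toSpanSingleton R R t) := by
      intro x hx
      rw [LinearMap.mem_ker, LinearMap.toSpanSingleton_apply]
      exact (mem_socle_iff t).1 ht x hx
    let f : ResidueField R →ₗ[R] R := Submodule.liftQ (maximalIdeal R) _ hk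
    have hf : f 1 = t := by
      change LinearMap.toSpanSingleton R R t 1 = t
      simp
    obtain ⟨a, ha⟩ := restriction_zero h hB (f ∘ₗ g)
    refine ⟨a, ?_⟩
    rw [← ha s hs, LinearMap.comp_apply, hg, hf]
  rw [socdim, moduleLength_eq] at hnotGor
  have := hnotGor.trans this
  norm_num at this

end Restriction

section Lengths

variable {R : Type} [CommRing R]

/-- Length of `Ext^i(X, Y)`. -/
noncomputable abbrev extLen (X Y : ModuleCat.{0} R) (i : ℕ) : ℕ∞ :=
  Module.length R (Abelian.Ext X Y i)

/-- Precomposition with a morphism. -/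
noncomputable def pre {X X' : ModuleCat.{0} R} (f : X ⟶ X') (Y : ModuleCat.{0} R) (i : ℕ) :
    Abelian.Ext X' Y i →ₗ[R] Abelian.Ext X Y i :=
  (Abelian.Ext.mk₀ f).precompOfLinear R Y (zero_add i)

lemma pre_apply {X X' : ModuleCat.{0} R} (f : X ⟶ X') (Y : ModuleCat.{0} R) (i : ℕ)
    (α : Abelian.Ext X' Y i) : pre f Y i α = (Abelian.Ext.mk₀ f).comp α (zero_add i) := rfl

lemma extLen_eq_of_equiv {X X' : Type} [AddCommGroup X] [Module R X] [AddCommGroup X'] [Module R X']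
    (e : X ≃ₗ[R] X') (Y : ModuleCat.{0} R) (i : ℕ) :
    extLen (ModuleCat.of R X) Y i = extLen (ModuleCat.of R X') Y i := by
  refine (LinearEquiv.ofLinearMap (pre (ModuleCat.ofHom e.symm.toLinearMap) Y i)
    (pre (ModuleCat.ofHom e.toLinearMap) Y i) ?_ ?_).length_eq
  · ext α
    rw [LinearMap.comp_apply, pre_apply, pre_apply, Abelian.Ext.mk₀_comp_mk₀_assoc,
      ← ModuleCat.ofHom_comp]
    simp
  · ext α
    rw [LinearMap.comp_apply, pre_apply, pre_apply, Abelian.Ext.mk₀_comp_mk₀_assoc,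
      ← ModuleCat.ofHom_comp]
    simp

lemma extLen_pi (K : Type) [AddCommGroup K] [Module R K] (v : ℕ) (Y : ModuleCat.{0} R) (i : ℕ) :
    extLen (ModuleCat.of R (Fin v → K)) Y i = v * extLen (ModuleCat.of R K) Y i := by
  let ι : (j : Fin v) → (ModuleCat.of R K ⟶ ModuleCat.of R (Fin v → K)) := fun j =>
    ModuleCat.ofHom (LinearMap.single R (fun _ => K) j)
  let π : (j : Fin v) → (ModuleCat.of R (Fin v → K) ⟶ ModuleCat.of R K) := fun j =>
    ModuleCat.ofHom (LinearMap.proj j)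
  have h1 : ∀ j, ι j ≫ π j = 𝟙 _ := by
    intro j
    ext x
    simp [ι, π]
  have h2 : ∀ j l, j ≠ l → ι j ≫ π l = 0 := by
    intro j l hjl
    ext x
    simp [ι, π, hjl.symm]
  have h3 : ∑ j, π j ≫ ι j = 𝟙 _ := by
    apply ModuleCat.hom_ext
    rw [ModuleCat.hom_sum]
    refine LinearMap.ext fun x => ?_
    rw [LinearMap.sum_apply]
    exact Finset.univ_sum_single x
  let Φ : Abelian.Ext (ModuleCat.of R (Fin v → K)) Y i →ₗ[R]
      (Fin v → Abelian.Ext (ModuleCat.of R K) Y i) := LinearMap.pi fun j => pre (ι j) Y i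
  have hΦ : Function.Bijective Φ := by
    constructor
    · rw [← LinearMap.ker_eq_bot, LinearMap.ker_eq_bot']
      intro x hx
      rw [← Abelian.Ext.mk₀_id_comp x, ← h3, Abelian.Ext.mk₀_sum, Abelian.Ext.sum_comp]
      refine Finset.sum_eq_zero fun j _ => ?_
      rw [← Abelian.Ext.mk₀_comp_mk₀_assoc, ← pre_apply (ι j)]
      have : pre (ι j) Y i x = 0 := congrFun hx j
      rw [this, Abelian.Ext.comp_zero]
    · intro y
      refine ⟨∑ j, pre (π j) Y i (y j), ?_⟩
      funext l
      change pre (ι l) Y i _ = y l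
      rw [map_sum, Finset.sum_eq_single l]
      · rw [pre_apply, pre_apply, Abelian.Ext.mk₀_comp_mk₀_assoc, h1, Abelian.Ext.mk₀_id_comp]
      · intro j _ hj
        rw [pre_apply, pre_apply, Abelian.Ext.mk₀_comp_mk₀_assoc, h2 l j hj.symm,
          Abelian.Ext.mk₀_zero, Abelian.Ext.zero_comp]
      · simp
  rw [extLen, (LinearEquiv.ofBijective Φ hΦ).length_eq, Module.length_pi_of_fintype]
  simp

/-- The rank of the restriction map. -/
noncomputable abbrev rho (S : ShortComplex (ModuleCat.{0} R)) (Y : ModuleCat.{0} R) (i : ℕ) : ℕ∞ :=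
  Module.length R (LinearMap.range (pre S.f Y i))

lemma length_eq_ker_add_range {A B : Type*} [AddCommGroup A] [AddCommGroup B] [Module R A]
    [Module R B] (f : A →ₗ[R] B) : Module.length R A =
      Module.length R (LinearMap.ker f) + Module.length R (LinearMap.range f) :=
  Module.length_eq_add_of_exact (LinearMap.ker f).subtype f.rangeRestrict
    (Submodule.injective_subtype _) (LinearMap.surjective_rangeRestrict f)
    (by rw [LinearMap.exact_iff, LinearMap.ker_rangeRestrict, Submodule.range_subtype])

lemma ker_pre_f {S : ShortComplex (ModuleCat.{0} R)} (hS : S.ShortExact) (Y : ModuleCat.{0} R)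
    (i : ℕ) : LinearMap.ker (pre S.f Y i) = LinearMap.range (pre S.g Y i) := by
  ext x
  constructor
  · intro h
    exact Abelian.Ext.contravariant_sequence_exact₂ hS Y x h
  · rintro ⟨y, rfl⟩
    rw [LinearMap.mem_ker, pre_apply, pre_apply, Abelian.Ext.mk₀_comp_mk₀_assoc, S.zero,
      Abelian.Ext.mk₀_zero, Abelian.Ext.zero_comp]

lemma len_zero {S : ShortComplex (ModuleCat.{0} R)} (hS : S.ShortExact) (Y : ModuleCat.{0} R) :
    extLen S.X₂ Y 0 = extLen S.X₃ Y 0 + rho S Y 0 := by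
  have hi : Function.Injective (pre S.g Y 0) := by
    have := hS.epi_g
    exact Abelian.Ext.precomp_mk₀_injective_of_epi _ _
  rw [extLen, length_eq_ker_add_range (pre S.f Y 0), ker_pre_f hS,
    ← (LinearEquiv.ofInjective _ hi).length_eq]

lemma len_succ {S : ShortComplex (ModuleCat.{0} R)} (hS : S.ShortExact) (Y : ModuleCat.{0} R)
    (i : ℕ) : extLen S.X₁ Y i + extLen S.X₂ Y (i + 1) =
      rho S Y i + extLen S.X₃ Y (i + 1) + rho S Y (i + 1) := by
  let δ : Abelian.Ext S.X₁ Y i →ₗ[R] Abelian.Ext S.X₃ Y (i + 1) :=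
    hS.extClass.precompOfLinear R Y (add_comm 1 i)
  have hδ : LinearMap.ker δ = LinearMap.range (pre S.f Y i) := by
    ext x
    constructor
    · intro h
      exact Abelian.Ext.contravariant_sequence_exact₁ hS Y x (add_comm 1 i) h
    · rintro ⟨y, rfl⟩
      exact hS.extClass_comp_assoc y (h := add_comm 1 i)
  have hg : LinearMap.ker (pre S.g Y (i + 1)) = LinearMap.range δ := by
    ext x
    constructor
    · intro h
      exact Abelian.Ext.contravariant_sequence_exact₃ hS Y x h (add_comm 1 i)
    · rintro ⟨y, rfl⟩
      exact hS.comp_extClass_assoc y (add_comm 1 i)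
  rw [extLen, length_eq_ker_add_range δ, hδ, extLen,
    length_eq_ker_add_range (pre S.f Y (i + 1)), ker_pre_f hS, extLen,
    length_eq_ker_add_range (pre S.g Y (i + 1)), hg]
  simp only [rho]
  abel

end Lengths

section Final

variable {R : Type} [CommRing R] [IsLocalRing R]

lemma exists_equiv_pi (V : Type) [AddCommGroup V] [Module R V] [Module.Finite R V]
    (hV : ∀ a ∈ maximalIdeal R, ∀ x : V, a • x = 0) :
    ∃ v : ℕ, Nonempty (V ≃ₗ[R] (Fin v → ResidueField R)) := by
  obtain ⟨d, f, hf, hk⟩ := exists_min_cover (R := R) V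
  let g : (Fin d → R) →ₗ[R] (Fin d → ResidueField R) :=
    (Algebra.linearMap R (ResidueField R)).compLeft (Fin d)
  have hg : Function.Surjective g := (residue_surjective (R := R)).comp_left
  have hfg : LinearMap.ker f = LinearMap.ker g := by
    ext x
    constructor
    · intro h
      exact funext fun i => (residue_eq_zero_iff (x i)).2 (hk x h i)
    · intro h
      rw [LinearMap.mem_ker, LinearMap.pi_apply_eq_sum_univ f x]
      exact Finset.sum_eq_zero fun i _ =>
        hV _ ((residue_eq_zero_iff (x i)).1 (congrFun h i)) _
  exact ⟨d, ⟨(f.quotKerEquivOfSurjective hf).symm ≪≫ₗ Submodule.quotEquivOfEq _ _ hfg ≪≫ₗ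
    g.quotKerEquivOfSurjective hg⟩⟩

lemma length_quot : Module.length R (R ⧸ maximalIdeal R) = 1 := by
  have : IsSimpleModule R (R ⧸ maximalIdeal R) := by
    rw [isSimpleModule_iff_isCoatom]
    exact (IsLocalRing.maximalIdeal.isMaximal R).out
  exact Module.length_eq_one R _

lemma length_k : Module.length R (ResidueField R) = 1 := length_quot

lemma extLen_killed (V : Type) [AddCommGroup V] [Module R V] [Module.Finite R V]
    (hV : ∀ a ∈ maximalIdeal R, ∀ x : V, a • x = 0) (Y : ModuleCat.{0} R) (i : ℕ) :
    extLen (ModuleCat.of R V) Y i =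
      Module.length R V * extLen (ModuleCat.of R (ResidueField R)) Y i := by
  obtain ⟨v, ⟨e⟩⟩ := exists_equiv_pi V hV
  rw [extLen_eq_of_equiv e, extLen_pi, e.length_eq, Module.length_pi_of_fintype]
  simp [length_k]

lemma length_killed_ne_top (V : Type) [AddCommGroup V] [Module R V] [Module.Finite R V]
    (hV : ∀ a ∈ maximalIdeal R, ∀ x : V, a • x = 0) : Module.length R V ≠ ⊤ := by
  obtain ⟨v, ⟨e⟩⟩ := exists_equiv_pi V hV
  rw [e.length_eq, Module.length_pi_of_fintype]
  simp [length_k]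

lemma extLen_R_zero : extLen (ModuleCat.of R R) (ModuleCat.of R R) 0 = Module.length R R :=
  (Abelian.Ext.linearEquiv₀ (R := R) ≪≫ₗ ModuleCat.homLinearEquiv (S := R) ≪≫ₗ
    LinearMap.ringLmapEquivSelf R R R).length_eq

lemma extLen_R_succ (i : ℕ) : extLen (ModuleCat.of R R) (ModuleCat.of R R) (i + 1) = 0 := by
  have : Projective (ModuleCat.of R R) :=
    (IsProjective.iff_projective (R := R) R).1 inferInstance
  rw [extLen, Module.length_eq_zero_iff]
  exact ⟨fun a b => by
    rw [Abelian.Ext.eq_zero_of_projective a, Abelian.Ext.eq_zero_of_projective b]⟩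

lemma extLen_k_zero : extLen (ModuleCat.of R (ResidueField R)) (ModuleCat.of R R) 0 =
    Module.length R (socle R) := by
  let ev : (ResidueField R →ₗ[R] R) →ₗ[R] R := LinearMap.applyₗ (1 : ResidueField R)
  have hi : Function.Injective ev := by
    intro f g hfg
    refine LinearMap.ext fun x => ?_
    obtain ⟨c, rfl⟩ := residue_surjective (R := R) x
    have hc : residue R c = c • (1 : ResidueField R) := by
      rw [Algebra.smul_def, ResidueField.algebraMap_eq, mul_one]
    rw [hc, map_smul, map_smul]
    exact congrArg (c • ·) hfg
  have hr : LinearMap.range ev = socle R := by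
    ext t
    rw [mem_socle_iff]
    constructor
    · rintro ⟨f, rfl⟩ a ha
      change a • f 1 = 0
      rw [← map_smul, smul_residue_eq_zero ha, map_zero]
    · intro ht
      have hk : ∀ x ∈ maximalIdeal R, x ∈ LinearMap.ker (LinearMap.toSpanSingleton R R t) := by
        intro x hx
        rw [LinearMap.mem_ker, LinearMap.toSpanSingleton_apply]
        exact ht x hx
      let f : ResidueField R →ₗ[R] R := Submodule.liftQ (maximalIdeal R) _ hk
      refine ⟨f, ?_⟩
      change LinearMap.toSpanSingleton R R t 1 = t
      simp
  exact (Abelian.Ext.linearEquiv₀ (R := R) ≪≫ₗ ModuleCat.homLinearEquiv (S := R) ≪≫ₗ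
    LinearEquiv.ofInjective ev hi ≪≫ₗ LinearEquiv.ofEq _ _ hr).length_eq

/-- `0 → S → m → m/m² → 0`. -/
noncomputable abbrev sesN (R : Type) [CommRing R] [IsLocalRing R]
    (h : socle R ≤ maximalIdeal R) (hs : socle R = maximalIdeal R ^ 2) :
    ShortComplex (ModuleCat.{0} R) :=
  ShortComplex.mk (ModuleCat.ofHom (Submodule.inclusion h))
    (ModuleCat.ofHom (X := maximalIdeal R) (Y := CotangentSpace R)
      (maximalIdeal R).toCotangent) (by
      ext x
      refine (Ideal.toCotangent_eq_zero _ _).2 ?_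
      rw [← hs]
      exact x.2)

lemma sesN_exact (h : socle R ≤ maximalIdeal R) (hs : socle R = maximalIdeal R ^ 2) :
    Function.Exact (Submodule.inclusion h) (maximalIdeal R).toCotangent := by
  intro x
  rw [Ideal.toCotangent_eq_zero, ← hs]
  constructor
  · intro hx
    exact ⟨⟨x.1, hx⟩, rfl⟩
  · rintro ⟨y, rfl⟩
    exact y.2

lemma sesN_shortExact (h : socle R ≤ maximalIdeal R) (hs : socle R = maximalIdeal R ^ 2) :
    (sesN R h hs).ShortExact :=
  ModuleCat.shortComplex_shortExact _ (sesN_exact h hs) (Submodule.inclusion_injective h)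
    (Ideal.toCotangent_surjective _)

lemma length_R (h : socle R ≤ maximalIdeal R) (hs : socle R = maximalIdeal R ^ 2) :
    Module.length R R = Module.length R (socle R) + Module.length R (CotangentSpace R) + 1 := by
  rw [Module.length_eq_add_of_exact (maximalIdeal R).subtype (maximalIdeal R).mkQ
    (Submodule.injective_subtype _) (Submodule.mkQ_surjective _)
    (LinearMap.exact_subtype_mkQ _), length_quot,
    Module.length_eq_add_of_exact (Submodule.inclusion h) (maximalIdeal R).toCotangent
      (Submodule.inclusion_injective h) (Ideal.toCotangent_surjective _) (sesN_exact h hs)]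

lemma rho_zero (h : socle R ≤ maximalIdeal R) (hs : socle R = maximalIdeal R ^ 2)
    (s : R) (hs0 : s ≠ 0) (hsS : s ∈ socle R)
    (hB : ∀ α : Abelian.Ext (ModuleCat.of R (ResidueField R)) (ModuleCat.of R R) (0 + 1),
      (Abelian.Ext.mk₀ (ModuleCat.ofHom (toK h))).comp α (zero_add _) = 0) :
    rho (sesN R h hs) (ModuleCat.of R R) 0 = 1 := by
  let x : Abelian.Ext (ModuleCat.of R (socle R)) (ModuleCat.of R R) 0 :=
    Abelian.Ext.mk₀ (ModuleCat.ofHom (socle R).subtype)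
  let T := LinearMap.toSpanSingleton R _ x
  have h1 : LinearMap.range (pre (sesN R h hs).f (ModuleCat.of R R) 0) = LinearMap.range T := by
    apply le_antisymm
    · rintro _ ⟨α, rfl⟩
      obtain ⟨φ, rfl⟩ := (Abelian.Ext.mk₀_bijective _ _).2 α
      obtain ⟨a, ha⟩ := restriction_zero h hB φ.hom
      refine ⟨a, ?_⟩
      rw [LinearMap.toSpanSingleton_apply, pre_apply, Abelian.Ext.mk₀_comp_mk₀,
        ← Abelian.Ext.mk₀_smul]
      congr 1
      ext t
      exact (ha t.1 t.2).symm
    · rintro _ ⟨a, rfl⟩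
      refine ⟨a • Abelian.Ext.mk₀ (ModuleCat.ofHom (maximalIdeal R).subtype), ?_⟩
      rw [map_smul, pre_apply, Abelian.Ext.mk₀_comp_mk₀]
      rfl
  have h2 : LinearMap.ker T = maximalIdeal R := by
    refine ((IsLocalRing.maximalIdeal.isMaximal R).eq_of_le ?_ ?_).symm
    · intro ht
      have h3 : T 1 = 0 := by
        have : (1 : R) ∈ LinearMap.ker T := by rw [ht]; trivial
        exact this
      rw [LinearMap.toSpanSingleton_apply, one_smul] at h3
      have h4 : (ModuleCat.ofHom (socle R).subtype :
          ModuleCat.of R (socle R) ⟶ ModuleCat.of R R) = 0 := by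
        apply (Abelian.Ext.mk₀_bijective _ _).1
        rw [Abelian.Ext.mk₀_zero]
        exact h3
      exact hs0 (congrArg (fun f => f.hom ⟨s, hsS⟩) h4)
    · intro a ha
      rw [LinearMap.mem_ker, LinearMap.toSpanSingleton_apply, ← Abelian.Ext.mk₀_smul]
      have : a • (ModuleCat.ofHom (socle R).subtype :
          ModuleCat.of R (socle R) ⟶ ModuleCat.of R R) = 0 := by
        ext t
        exact (mem_socle_iff t.1).1 t.2 a ha
      rw [this, Abelian.Ext.mk₀_zero]
  rw [rho, h1, ← T.quotKerEquivRange.length_eq, h2, length_quot]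

lemma rho_pos (h : socle R ≤ maximalIdeal R) (hs : socle R = maximalIdeal R ^ 2) (i : ℕ)
    (hB : ∀ α : Abelian.Ext (ModuleCat.of R (ResidueField R)) (ModuleCat.of R R) (i + 1 + 1),
      (Abelian.Ext.mk₀ (ModuleCat.ofHom (toK h))).comp α (zero_add _) = 0) :
    rho (sesN R h hs) (ModuleCat.of R R) (i + 1) = 0 := by
  have : pre (sesN R h hs).f (ModuleCat.of R R) (i + 1) = 0 := by
    ext α
    exact restriction_pos h i α hB
  rw [rho, this, LinearMap.range_zero, Module.length_eq_zero_iff]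
  infer_instance

lemma rhoM_pos (i : ℕ) : rho (sesM R) (ModuleCat.of R R) (i + 1) = 0 := by
  have h := extLen_R_succ (R := R) i
  rw [extLen, length_eq_ker_add_range (pre (sesM R).f (ModuleCat.of R R) (i + 1))] at h
  exact (add_eq_zero.1 h).2

lemma bassNum_eq (i : ℕ) : bassNum R i =
    extLen (ModuleCat.of R (ResidueField R)) (ModuleCat.of R R) i := by
  rw [bassNum, moduleLength_eq]
  obtain ⟨e⟩ := exists_equiv (ModuleCat.of R (ResidueField R)) (ModuleCat.of R R) i
  exact e.length_eq

end Final

/-- Let `(R, m, k)` be a local ring with `m³ = 0 ≠ m²` which is not Gorenstein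
(equivalently, `r ≥ 2`).  If there exists a finitely generated non-free `R`-module `M`
with `Ext^{n+1}_R(M, R) = 0` for some `n ≥ 2`, then the Bass numbers of `R` satisfy
`μ⁰ = r`, `μ¹ = e·(r − 1)`, `μ² = e·μ¹ − r² + 1` and `μ^i = e·μ^{i−1} − r·μ^{i−2}` for
`3 ≤ i ≤ n` (the equalities involving subtraction are stated in rearranged,
subtraction-free form). -/
theorem bass_numbers (R : Type) [CommRing R] [IsNoetherianRing R] [IsLocalRing R]
    (h3 : maximalIdeal R ^ 3 = ⊥) (h2 : maximalIdeal R ^ 2 ≠ ⊥)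
    (hnotGor : 2 ≤ socdim R) (n : ℕ) (hn : 2 ≤ n)
    (hM : ∃ (M : Type) (_ : AddCommGroup M) (_ : Module R M), Module.Finite R M ∧
      ¬ Module.Free R M ∧ Subsingleton (extModule R M R (n + 1)).carrier) :
    bassNum R 0 = socdim R ∧
    bassNum R 1 + embdim R = embdim R * socdim R ∧
    bassNum R 2 + socdim R ^ 2 = embdim R * bassNum R 1 + 1 ∧
    ∀ i : ℕ, 3 ≤ i → i ≤ n →
      bassNum R i + socdim R * bassNum R (i - 2) = embdim R * bassNum R (i - 1) := by
  obtain ⟨M, _, _, hfin, hfree, hsub⟩ := hM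
  have hext : Subsingleton (Abelian.Ext (ModuleCat.of R M) (ModuleCat.of R R) (n + 1)) := by
    obtain ⟨e⟩ := exists_equiv (ModuleCat.of R M) (ModuleCat.of R R) (n + 1)
    have : Subsingleton ((((_root_.Ext R (ModuleCat R) (n + 1)).obj
      (Opposite.op (ModuleCat.of R M))).obj (ModuleCat.of R R))) := hsub
    exact e.symm.injective.subsingleton
  have h := socle_le h2
  obtain ⟨s, hs, hs0⟩ : ∃ s ∈ socle R, s ≠ 0 := by
    obtain ⟨s, hs, hs0⟩ := Submodule.exists_mem_ne_zero_of_ne_bot h2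
    exact ⟨s, sq_le_socle h3 hs, hs0⟩
  have hB := lemmaB h s hs0 hs n M hfree hext
  have hsoc := socle_eq h3 h hnotGor (hB 0 (by omega))
  have hkS : ∀ a ∈ maximalIdeal R, ∀ x : socle R, a • x = 0 := fun a ha x =>
    Subtype.ext ((mem_socle_iff x.1).1 x.2 a ha)
  have hkC : ∀ a ∈ maximalIdeal R, ∀ x : CotangentSpace R, a • x = 0 := by
    intro a ha x
    obtain ⟨y, rfl⟩ := Ideal.toCotangent_surjective _ x
    rw [← map_smul, Ideal.toCotangent_eq_zero, pow_two]
    exact Ideal.mul_mem_mul ha y.2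
  have hrfin := length_killed_ne_top (socle R) hkS
  have hCfin : Module.Finite R (CotangentSpace R) :=
    Module.Finite.of_surjective _ (Ideal.toCotangent_surjective (maximalIdeal R))
  have hSi := extLen_killed (socle R) hkS (ModuleCat.of R R)
  have hCi := extLen_killed (CotangentSpace R) hkC (ModuleCat.of R R)
  have hk0 := extLen_k_zero (R := R)
  have hM0 := len_zero (sesM_shortExact (R := R)) (ModuleCat.of R R)
  have hMi := len_succ (sesM_shortExact (R := R)) (ModuleCat.of R R)
  have hN0 := len_zero (sesN_shortExact h hsoc) (ModuleCat.of R R)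
  have hNi := len_succ (sesN_shortExact h hsoc) (ModuleCat.of R R)
  have hlR := length_R h hsoc
  rw [rho_zero h hsoc s hs0 hs (hB 0 (by omega))] at hN0
  have hrho := fun i (hi : i + 1 + 1 ≤ n) => rho_pos h hsoc i (hB (i + 1) hi)
  dsimp only at hM0 hMi hN0 hNi
  rw [extLen_R_zero, hlR, hk0] at hM0
  simp only [extLen_R_succ, rhoM_pos, add_zero] at hMi
  simp only [hSi, hCi] at hN0 hNi
  have hm : ∀ i, extLen (ModuleCat.of R (maximalIdeal R)) (ModuleCat.of R R) (i + 1) =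
      extLen (ModuleCat.of R (ResidueField R)) (ModuleCat.of R R) (i + 1 + 1) := by
    intro i
    rw [hMi, rhoM_pos, zero_add]
  simp only [bassNum_eq, socdim, embdim, moduleLength_eq]
  rw [hk0] at hN0
  refine ⟨hk0, ?_, ?_, ?_⟩
  · have e1 : rho (sesM R) (ModuleCat.of R R) 0 =
        Module.length R (CotangentSpace R) + 1 := by
      rw [add_assoc] at hM0
      exact (WithTop.add_left_cancel hrfin hM0).symm
    have e2 := hMi 0
    rw [hN0, e1] at e2
    have e3 : (1 : ℕ∞) ≠ ⊤ := by simp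
    have e4 : Module.length R (CotangentSpace R) * Module.length R (socle R) + 1 =
        extLen (ModuleCat.of R (ResidueField R)) (ModuleCat.of R R) 1 +
          Module.length R (CotangentSpace R) + 1 := by
      rw [e2]; simp only [zero_add]; ring
    exact (WithTop.add_right_cancel e3 e4).symm
  · have e1 := hNi 0
    rw [hrho 0 hn, rho_zero h hsoc s hs0 hs (hB 0 (by omega)), hk0, hm 0] at e1
    simp only [zero_add, add_zero] at e1
    rw [pow_two, add_comm, add_comm _ (1 : ℕ∞)]
    exact e1
  · intro i hi hin
    obtain ⟨j, rfl⟩ : ∃ j, i = j + 1 + 1 + 1 := ⟨i - 3, by omega⟩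
    have e1 := hNi (j + 1)
    rw [hrho j (by omega), hrho (j + 1) hin, hm] at e1
    simp only [zero_add, add_zero] at e1
    rw [add_comm]
    exact e1
end

section
/- (Theorem A(a)) Assume R is not Gorenstein (equivalently, r ≥ 2). If there exists a non-zero minimal acyclic complex A of finitely generated free R-modules, then (0 :_R m) = m². -/
open IsLocalRing CategoryTheory

/-- Vanishing of the `i`-th homology of the dual complex `A* = Hom_R(A, R)` of a chain
complex `A` with differentials `d i : A (i+1) → A i` (so that `∂_j = d (j-1)`):
every functional on `A_i` vanishing on the image of `∂_{i+1}` factors through `∂_i`.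
(The index `i` is written as `i - 1 + 1` for type-checking reasons.)  Together with the
automatic inclusion `im ∂*_i ⊆ ker ∂*_{i+1}`, this says exactly `H_i(A*) = 0`. -/
def dualHomologyIsZero (R : Type) [CommRing R] (A : ℤ → Type) [∀ i, AddCommGroup (A i)]
    [∀ i, Module R (A i)] (d : ∀ i : ℤ, A (i + 1) →ₗ[R] A i) (i : ℤ) : Prop :=
  ∀ f : A (i - 1 + 1) →ₗ[R] R, f ∘ₗ d (i - 1 + 1) = 0 →
    ∃ g : A (i - 1) →ₗ[R] R, f = g ∘ₗ d (i - 1)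

/-- If `x • g ∈ m² G` for a free module `G` and `x ∉ m²` then `g ∈ m G`. -/
theorem aux_mem (R : Type) [CommRing R] [IsLocalRing R] (x : R)
    (hx : x ∉ maximalIdeal R ^ 2) (G : Type) [AddCommGroup G] [Module R G]
    [Module.Free R G] [Module.Finite R G] (g : G)
    (hg : x • g ∈ (maximalIdeal R ^ 2) • (⊤ : Submodule R G)) :
    g ∈ maximalIdeal R • (⊤ : Submodule R G) := by
  let b := Module.Free.chooseBasis R G
  rw [← b.sum_repr g]
  refine Submodule.sum_mem _ fun j _ => Submodule.smul_mem_smul ?_ trivial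
  rw [mem_maximalIdeal, mem_nonunits_iff]
  intro hu
  apply hx
  have h1 : b.coord j (x • g) ∈ maximalIdeal R ^ 2 := by
    have := Submodule.mem_map_of_mem (f := b.coord j) hg
    rw [Submodule.map_smul''] at this
    have h := (Submodule.smul_mono (le_refl (maximalIdeal R ^ 2))
      (le_top : Submodule.map (b.coord j) ⊤ ≤ ⊤)) this
    simpa using h
  rw [map_smul, smul_eq_mul, Module.Basis.coord_apply] at h1
  exact (Ideal.mul_unit_mem_iff_mem _ hu).1 h1

open scoped TensorProduct in
/-- The key comparison. -/
theorem aux_key (R : Type) [CommRing R] [IsLocalRing R] (x : R)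
    (hx : x ∉ maximalIdeal R ^ 2) (F G : Type) [AddCommGroup G] [Module R G]
    [Module.Free R G] [Module.Finite R G] [AddCommGroup F] [Module R F]
    [Module.Free R F] [Module.Finite R F] (d : F →ₗ[R] G)
    (hmin : LinearMap.range d ≤ maximalIdeal R • (⊤ : Submodule R G))
    (hxd : ∀ g : G, x • g ∈ LinearMap.range d) :
    Module.finrank R G ≤ Module.finrank R F ∧
    (Module.finrank R F ≤ Module.finrank R G → ∀ f, ∃ g, d f = x • g) := by
  let b := Module.Free.chooseBasis R G
  choose a ha using fun j => hxd (b j)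
  let φ : G →ₗ[R] F := b.constr R a
  have hφ : ∀ g, d (φ g) = x • g := by
    intro g
    have : d ∘ₗ φ = x • LinearMap.id := b.ext fun j => by simp [φ, ha]
    exact LinearMap.congr_fun this g
  have hmem : ∀ g, φ g ∈ maximalIdeal R • (⊤ : Submodule R F) →
      g ∈ maximalIdeal R • (⊤ : Submodule R G) := by
    intro g hg
    apply aux_mem R x hx
    rw [← hφ]
    have := Submodule.mem_map_of_mem (f := d) hg
    rw [Submodule.map_smul'', Submodule.map_top] at this
    have h := (Submodule.smul_mono (le_refl (maximalIdeal R)) hmin) this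
    rwa [← Submodule.mul_smul, ← pow_two] at h
  let c := Module.Free.chooseBasis R F
  let ψ := φ.baseChange (ResidueField R)
  have hinj : Function.Injective ψ := by
    rw [injective_iff_map_eq_zero]
    intro t ht
    obtain ⟨g, rfl⟩ := TensorProduct.mk_surjective R G (ResidueField R)
      IsLocalRing.residue_surjective t
    have ht' : (1 : ResidueField R) ⊗ₜ[R] φ g = 0 := by simpa [ψ] using ht
    have h1 := TensorProduct.quotTensorEquivQuotSMul_mk_one_tmul (maximalIdeal R) (φ g)
    have h2 : (1 : R ⧸ maximalIdeal R) ⊗ₜ[R] φ g = 0 := ht'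
    rw [h2, map_zero, eq_comm, Submodule.Quotient.mk_eq_zero] at h1
    have h3 := TensorProduct.quotTensorEquivQuotSMul_symm_mk (maximalIdeal R) g
    rw [(Submodule.Quotient.mk_eq_zero _).2 (hmem g h1), map_zero] at h3
    exact h3.symm
  have e1 : Module.finrank (ResidueField R) (TensorProduct R (ResidueField R) G)
    = Module.finrank R G := Module.finrank_baseChange
  have e2 : Module.finrank (ResidueField R) (TensorProduct R (ResidueField R) F)
    = Module.finrank R F := Module.finrank_baseChange
  have hle := LinearMap.finrank_le_finrank_of_injective hinj
  refine ⟨by omega, fun h f => ?_⟩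
  have hs : Function.Surjective ψ :=
    (LinearMap.injective_iff_surjective_of_finrank_eq_finrank (by omega)).1 hinj
  have hsφ : Function.Surjective φ := by
    rw [← LinearMap.range_eq_top, ← IsLocalRing.map_tensorProduct_mk_eq_top, eq_top_iff]
    rintro t -
    obtain ⟨u, rfl⟩ := hs t
    obtain ⟨g, rfl⟩ := TensorProduct.mk_surjective R G (ResidueField R)
      IsLocalRing.residue_surjective u
    exact ⟨φ g, ⟨g, rfl⟩, by simp [ψ]⟩
  obtain ⟨g, rfl⟩ := hsφ f
  exact ⟨g, hφ g⟩

/-- Theorem A(a): let `(R, m, k)` be a local ring with `m³ = 0 ≠ m²` which is not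
Gorenstein (equivalently, `r ≥ 2`).  If there exists a non-zero minimal acyclic complex
`A` (with differentials `d i : A (i+1) → A i`, i.e. `∂_j = d (j-1)`) of finitely
generated free `R`-modules, then `(0 :_R m) = m²`. -/
theorem socle_eq_sq (R : Type) [CommRing R] [IsNoetherianRing R] [IsLocalRing R]
    (h3 : maximalIdeal R ^ 3 = ⊥) (h2 : maximalIdeal R ^ 2 ≠ ⊥)
    (hnotGor : 2 ≤ socdim R)
    (A : ℤ → Type) [∀ i, AddCommGroup (A i)] [∀ i, Module R (A i)]
    (hfree : ∀ i, Module.Free R (A i)) (hfin : ∀ i, Module.Finite R (A i))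
    (d : ∀ i : ℤ, A (i + 1) →ₗ[R] A i)
    (hcx : ∀ i, d i ∘ₗ d (i + 1) = 0)
    (hacyclic : ∀ i, LinearMap.range (d (i + 1)) = LinearMap.ker (d i))
    (hmin : ∀ i, LinearMap.range (d i) ≤ maximalIdeal R • (⊤ : Submodule R (A i)))
    (hnz : ∃ i, Nontrivial (A i)) :
    socle R = maximalIdeal R ^ 2 := by
  apply le_antisymm
  · by_contra hcon
    obtain ⟨x, hxs, hx⟩ := Set.not_subset.1 hcon
    have hxm : ∀ y ∈ maximalIdeal R, x * y = 0 := by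
      intro y hy
      simpa using Submodule.mem_colon.1 hxs y hy
    have hxmem : x ∈ maximalIdeal R := by
      rw [mem_maximalIdeal, mem_nonunits_iff]
      intro hu
      apply h2
      rw [eq_bot_iff]
      intro y hy
      have := hxm y (Ideal.pow_le_self two_ne_zero hy)
      simpa using (hu.mul_right_eq_zero).1 this
    have hxz : ∀ (M : Type) [AddCommGroup M] [Module R M] (z : M),
        z ∈ maximalIdeal R • (⊤ : Submodule R M) → x • z = 0 := by
      intro M _ _ z hz
      induction hz using Submodule.smul_induction_on' with
      | smul r hr n _ => rw [smul_smul, hxm r hr, zero_smul]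
      | add u _ v _ hu hv => rw [smul_add, hu, hv, add_zero]
    have hstep : ∀ i, Nontrivial (A (i + 1)) → Nontrivial (A i) := by
      intro i hi
      by_contra hn
      rw [not_nontrivial_iff_subsingleton] at hn
      have hk : LinearMap.range (d (i + 1)) = ⊤ := by
        rw [hacyclic, LinearMap.ker_eq_top]
        ext; exact Subsingleton.elim _ _
      have h := hmin (i + 1)
      rw [hk] at h
      have := Submodule.eq_bot_of_le_smul_of_le_jacobson_bot (maximalIdeal R)
        (⊤ : Submodule R (A (i + 1))) Module.Finite.fg_top h
        (IsLocalRing.maximalIdeal_le_jacobson _)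
      exact top_ne_bot this
    have hkey := fun i => aux_key R x hx (A (i + 1 + 1)) (A (i + 1)) (d (i + 1))
      (hmin (i + 1)) (fun g => by
        rw [hacyclic, LinearMap.mem_ker, map_smul]
        exact hxz _ _ (hmin i ⟨g, rfl⟩))
    let S : Set ℕ := {n | ∃ j, Nontrivial (A j) ∧ Module.finrank R (A j) = n}
    have hS : S.Nonempty := by
      obtain ⟨i, hi⟩ := hnz
      exact ⟨_, i, hi, rfl⟩
    obtain ⟨j, hj, hjn⟩ := Nat.sInf_mem hS
    have hle : ∀ l, Nontrivial (A l) → Module.finrank R (A j) ≤ Module.finrank R (A l) :=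
      fun l hl => hjn ▸ Nat.sInf_le ⟨l, hl, rfl⟩
    obtain ⟨i, rfl⟩ : ∃ i, j = i + 1 + 1 + 1 := ⟨j - 3, by ring⟩
    have n2 := hstep _ hj
    have n1 := hstep _ n2
    have k1 := (hkey i)
    have k2 := (hkey (i + 1))
    have l1 := hle _ n1
    have l2 := hle _ n2
    have r1 := k1.2 (by omega)
    have r2 := k2.2 (by omega)
    let b := Module.Free.chooseBasis R (A (i + 1 + 1))
    obtain ⟨t⟩ : Nonempty (Module.Free.ChooseBasisIndex R (A (i + 1 + 1))) := b.index_nonempty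
    have hspan : ∀ y ∈ maximalIdeal R, ∃ z, y = x * z := by
      intro y hy
      have : y • b t ∈ LinearMap.range (d (i + 1 + 1)) := by
        rw [hacyclic, LinearMap.mem_ker, map_smul]
        obtain ⟨g, hg⟩ := r1 (b t)
        rw [hg, smul_smul, mul_comm, hxm y hy, zero_smul]
      obtain ⟨f, hf⟩ := this
      obtain ⟨g, hg⟩ := r2 f
      refine ⟨b.coord t g, ?_⟩
      have := congrArg (b.coord t) (hf.symm.trans hg)
      simpa using this
    apply h2
    rw [eq_bot_iff, pow_two, Ideal.mul_le]
    intro y hy w hw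
    obtain ⟨z, rfl⟩ := hspan y hy
    have := hxm w hw
    rw [Ideal.mem_bot, mul_right_comm, this, zero_mul]
  · intro y hy
    refine Submodule.mem_colon.2 fun z hz => ?_
    rw [← h3, pow_succ]
    exact Ideal.mul_mem_mul hy hz
end

section
/- (Theorem A(c)) Assume R is not Gorenstein (equivalently, r ≥ 2). If there exists a non-zero minimal acyclic complex A of finitely generated free R-modules, then the Betti numbers of the residue field k satisfy β_i^R(k) = ∑_{j=0}^{i} r^j for all i ≥ 0; equivalently, the Poincaré series of k is P_k^R(t) = 1/((1 − t)(1 − r·t)). -/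
open IsLocalRing CategoryTheory

namespace PS

abbrev XExt (R : Type) [CommRing R] (M N : Type) [AddCommGroup M] [Module R M]
    [AddCommGroup N] [Module R N] (n : ℕ) : Type :=
  Abelian.Ext (ModuleCat.of R M) (ModuleCat.of R N) n

theorem moduleLength_eq (R M : Type) [Ring R] [AddCommGroup M] [Module R M] :
    moduleLength R M = Module.length R M := by
  apply WithBot.coe_injective
  rw [Module.coe_length, Order.krullDim_eq_iSup_length]
  rfl

theorem extMk_zero_iff {C : Type*} [Category C] [Abelian C] [HasExt C]
  {X Y : C} (P : ProjectiveResolution X) (f : P.complex.X 0 ⟶ Y) 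
    (hf : P.complex.d 1 0 ≫ f = 0) :
    P.extMk f 1 rfl hf = 0 ↔ f = 0 := by
  constructor
  · intro h
    simp only [← P.extEquivCohomologyClass.apply_eq_iff_eq,
      ProjectiveResolution.extEquivCohomologyClass_extMk, ProjectiveResolution.extEquivCohomologyClass_zero,
      CochainComplex.HomComplex.CohomologyClass.mk_eq_zero_iff] at h
    rw [CochainComplex.HomComplex.Cocycle.toSingleMk_mem_coboundaries_iff _ _ _ _ _ (1 : ℤ) (by lia)] at h
    obtain ⟨g, hg⟩ := h
    have hz : Limits.IsZero (P.cochainComplex.X 1) :=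
      P.cochainComplex.isZero_of_isStrictlyLE 0 1 (by simp)
    rw [hz.eq_of_src g 0, Limits.comp_zero] at hg
    rw [← cancel_epi (P.cochainComplexXIso (-(0:ℕ)) 0 rfl).hom]
    simpa using hg.symm
  · rintro rfl
    simp

theorem extMk_smul {R : Type} [CommRing R] {X Y : ModuleCat.{0} R} (P : ProjectiveResolution X) {n : ℕ}
    (f : P.complex.X n ⟶ Y) (m : ℕ) (hm : n + 1 = m)
    (hf : P.complex.d m n ≫ f = 0) (a : R) :
    P.extMk (a • f) m hm (by simp [hf]) = a • P.extMk f m hm hf := by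
  rw [Abelian.Ext.smul_eq_comp_mk₀, ProjectiveResolution.extMk_comp_mk₀]
  congr 1

theorem bridge_aux {R : Type} [CommRing R] {X Y : ModuleCat.{0} R} (P : ProjectiveResolution X)
    (p n : ℕ) (hp : (p + 1 = n) ∨ (n = 0 ∧ p = 0)) :
    Module.length R (LinearMap.ker ((P.complex.linearYonedaObj R Y).sc' p n (n + 1)).g.hom ⧸
      LinearMap.range ((P.complex.linearYonedaObj R Y).sc' p n (n + 1)).moduleCatToCycles) =
    Module.length R (Abelian.Ext X Y n) := by
  have hker : ∀ x : (P.complex.X n ⟶ Y),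
      x ∈ LinearMap.ker ((P.complex.linearYonedaObj R Y).sc' p n (n + 1)).g.hom ↔
      P.complex.d (n+1) n ≫ x = 0 := by
    intro x
    rfl
  let φ : LinearMap.ker ((P.complex.linearYonedaObj R Y).sc' p n (n + 1)).g.hom →ₗ[R]
      Abelian.Ext X Y n :=
    { toFun := fun x => P.extMk (x.1 : P.complex.X n ⟶ Y) (n+1) rfl ((hker _).1 x.2)
      map_add' := fun x y => (P.add_extMk (x.1 : P.complex.X n ⟶ Y) (y.1 : P.complex.X n ⟶ Y) (n+1) rfl
        ((hker _).1 x.2) ((hker _).1 y.2)).symm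
      map_smul' := fun a x => extMk_smul P (x.1 : P.complex.X n ⟶ Y) (n+1) rfl ((hker _).1 x.2) a }
  have hsurj : Function.Surjective φ := by
    intro α
    obtain ⟨f, hf, h⟩ := P.extMk_surjective α (n+1) rfl
    exact ⟨⟨f, (hker f).2 hf⟩, h⟩
  have hk : LinearMap.ker φ = LinearMap.range
      ((P.complex.linearYonedaObj R Y).sc' p n (n + 1)).moduleCatToCycles := by
    ext ⟨x, hx⟩
    rw [LinearMap.mem_ker, LinearMap.mem_range]
    change P.extMk (x : P.complex.X n ⟶ Y) (n+1) rfl ((hker _).1 hx) = 0 ↔ _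
    have h2 : (∃ y, ((P.complex.linearYonedaObj R Y).sc' p n (n + 1)).moduleCatToCycles y
        = ⟨x, hx⟩) ↔ ∃ g : P.complex.X p ⟶ Y, P.complex.d n p ≫ g = x := by
      constructor
      · rintro ⟨y, hy⟩
        exact ⟨y, congrArg Subtype.val hy⟩
      · rintro ⟨y, hy⟩
        exact ⟨y, Subtype.ext hy⟩
    rw [h2]
    rcases hp with hp | ⟨rfl, rfl⟩
    · exact P.extMk_eq_zero_iff _ _ _ _ p hp
    · refine (extMk_zero_iff P (x : P.complex.X 0 ⟶ Y) ((hker _).1 hx)).trans ?_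
      have h0 : P.complex.d 0 0 = 0 := P.complex.shape _ _ (by simp)
      constructor
      · intro h
        exact ⟨0, by rw [h]; simp⟩
      · rintro ⟨g, hg⟩
        rw [← hg, h0, Limits.zero_comp]
  exact ((Submodule.quotEquivOfEq _ _ hk.symm).trans
    (φ.quotKerEquivOfSurjective hsurj)).length_eq

theorem bridge (R : Type) [CommRing R] (M N : Type) [AddCommGroup M] [Module R M]
    [AddCommGroup N] [Module R N] (n : ℕ) :
    Module.length R (extModule R M N n).carrier = Module.length R (XExt R M N n) := by
  let P := ProjectiveResolution.of (ModuleCat.of R M)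
  let K := P.complex.linearYonedaObj R (ModuleCat.of R N)
  let e1 : (extModule R M N n) ≅ K.homology n := P.isoExt n (ModuleCat.of R N)
  obtain ⟨p, hp, hp'⟩ : ∃ p, (ComplexShape.up ℕ).prev n = p ∧
      ((p + 1 = n) ∨ (n = 0 ∧ p = 0)) := by
    cases n with
    | zero => exact ⟨0, by simp, Or.inr ⟨rfl, rfl⟩⟩
    | succ n => exact ⟨n, by simp, Or.inl rfl⟩
  let e3 : K.homology n ≅ (K.sc' p n (n+1)).homology :=
    ShortComplex.homologyMapIso (K.isoSc' p n (n+1) hp (by simp))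
  let e2 := (K.sc' p n (n+1)).moduleCatHomologyIso
  rw [(e1 ≪≫ e3 ≪≫ e2).toLinearEquiv.length_eq]
  exact bridge_aux P p n hp'

end PS
namespace PS

section ExtInterface

variable {R : Type} [CommRing R]

/-- contravariant functoriality of Ext as linear map. -/
noncomputable def pre {M N : Type} [AddCommGroup M] [Module R M] [AddCommGroup N] [Module R N]
    (f : M →ₗ[R] N) (Y : Type) [AddCommGroup Y] [Module R Y] (n : ℕ) :
    XExt R N Y n →ₗ[R] XExt R M Y n :=
  (Abelian.Ext.mk₀ (ModuleCat.ofHom f)).precompOfLinear R (ModuleCat.of R Y) (zero_add n)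

variable {M N L Y : Type} [AddCommGroup M] [Module R M] [AddCommGroup N] [Module R N]
  [AddCommGroup L] [Module R L] [AddCommGroup Y] [Module R Y]

theorem pre_apply (f : M →ₗ[R] N) (n : ℕ) (x : XExt R N Y n) :
    pre f Y n x = (Abelian.Ext.mk₀ (ModuleCat.ofHom f)).comp x (zero_add n) := rfl

theorem pre_comp (f : M →ₗ[R] N) (g : N →ₗ[R] L) (n : ℕ) (x : XExt R L Y n) :
    pre f Y n (pre g Y n x) = pre (g ∘ₗ f) Y n x := by
  rw [pre_apply, pre_apply, pre_apply, Abelian.Ext.mk₀_comp_mk₀_assoc]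
  rfl

theorem pre_id (n : ℕ) (x : XExt R M Y n) : pre LinearMap.id Y n x = x := by
  rw [pre_apply]
  exact Abelian.Ext.mk₀_id_comp x

theorem pre_zero (n : ℕ) (x : XExt R N Y n) : pre (0 : M →ₗ[R] N) Y n x = 0 := by
  rw [pre_apply]
  have : ModuleCat.ofHom (0 : M →ₗ[R] N) = 0 := rfl
  rw [this, Abelian.Ext.mk₀_zero, Abelian.Ext.zero_comp]

theorem pre_add (f g : M →ₗ[R] N) (n : ℕ) (x : XExt R N Y n) :
    pre (f + g) Y n x = pre f Y n x + pre g Y n x := by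
  simp only [pre_apply]
  have : ModuleCat.ofHom (f + g) = ModuleCat.ofHom f + ModuleCat.ofHom g := rfl
  rw [this, Abelian.Ext.mk₀_add, Abelian.Ext.add_comp]

theorem ext_congr (e : M ≃ₗ[R] N) (n : ℕ) :
    Module.length R (XExt R M Y n) = Module.length R (XExt R N Y n) := by
  apply LinearEquiv.length_eq
  refine LinearEquiv.ofLinear (pre e.symm.toLinearMap Y n) (pre e.toLinearMap Y n) ?_ ?_
  · ext x
    simp [pre_comp, pre_id]
  · ext x
    simp [pre_comp, pre_id]

/-- Additivity of Ext along a decomposition. -/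
theorem ext_split (i : M →ₗ[R] N) (p : N →ₗ[R] M) (j : L →ₗ[R] N) (q : N →ₗ[R] L)
    (h1 : p ∘ₗ i = LinearMap.id) (h2 : q ∘ₗ j = LinearMap.id)
    (h3 : p ∘ₗ j = 0) (h4 : q ∘ₗ i = 0) (h5 : i ∘ₗ p + j ∘ₗ q = LinearMap.id) (n : ℕ) :
    Module.length R (XExt R N Y n) =
      Module.length R (XExt R M Y n) + Module.length R (XExt R L Y n) := by
  rw [← Module.length_prod]
  apply LinearEquiv.length_eq
  refine LinearEquiv.ofLinear ((pre i Y n).prod (pre j Y n))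
    ((pre p Y n).coprod (pre q Y n)) ?_ ?_
  · apply LinearMap.ext
    rintro ⟨x, y⟩
    simp [pre_comp, h1, h2, h3, h4, pre_id, pre_zero]
  · apply LinearMap.ext
    intro x
    simp [pre_comp, ← pre_add, h5, pre_id]

theorem ext_prod (n : ℕ) : Module.length R (XExt R (M × N) Y n) =
      Module.length R (XExt R M Y n) + Module.length R (XExt R N Y n) := by
  refine ext_split (LinearMap.inl R M N) (LinearMap.fst R M N) (LinearMap.inr R M N)
    (LinearMap.snd R M N) ?_ ?_ ?_ ?_ ?_ n <;> ext <;> simp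

theorem ext_subsingleton [Subsingleton M] (n : ℕ) : Module.length R (XExt R M Y n) = 0 := by
  rw [Module.length_eq_zero_iff]
  refine subsingleton_of_forall_eq 0 fun x => ?_
  rw [← pre_id n x, Subsingleton.elim (LinearMap.id : M →ₗ[R] M) 0, pre_zero]

theorem ext_pi (s n : ℕ) : Module.length R (XExt R (Fin s → M) Y n) =
      s * Module.length R (XExt R M Y n) := by
  induction s with
  | zero => simpa using ext_subsingleton n
  | succ s ih =>
    rw [← ext_congr (Fin.consLinearEquiv R (fun _ : Fin (s+1) => M)) n]
    rw [ext_prod, ih]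
    push_cast
    ring

/-- The short exact sequence. -/
theorem mkSES (f : M →ₗ[R] N) (g : N →ₗ[R] L) (hf : Function.Injective f)
    (hg : Function.Surjective g) (hfg : LinearMap.range f = LinearMap.ker g) :
    (ShortComplex.mk (ModuleCat.ofHom f) (ModuleCat.ofHom g) (by
      ext x
      have : f x ∈ LinearMap.ker g := hfg ▸ ⟨x, rfl⟩
      exact this)).ShortExact := by
  refine ShortComplex.ShortExact.mk' ?_ ?_ ?_
  · rw [ShortComplex.moduleCat_exact_iff_range_eq_ker]
    exact hfg
  · exact (ModuleCat.mono_iff_injective _).2 hf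
  · exact (ModuleCat.epi_iff_surjective _).2 hg

theorem ext_middle (f : M →ₗ[R] N) (g : N →ₗ[R] L) (hf : Function.Injective f)
    (hg : Function.Surjective g) (hfg : LinearMap.range f = LinearMap.ker g) (n : ℕ) :
    Module.length R (XExt R L Y (n+1)) ≤
      Module.length R (XExt R M Y n) + Module.length R (XExt R N Y (n+1)) := by
  have hS := mkSES f g hf hg hfg
  let δ : XExt R M Y n →ₗ[R] XExt R L Y (n+1) :=
    hS.extClass.precompOfLinear R (ModuleCat.of R Y) (add_comm 1 n)
  let q := pre g Y (n+1)
  have hker : LinearMap.ker q ≤ LinearMap.range δ := by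
    intro x hx
    obtain ⟨y, hy⟩ := Abelian.Ext.contravariant_sequence_exact₃ hS (ModuleCat.of R Y) x hx (add_comm 1 n)
    exact ⟨y, hy⟩
  have e := Module.length_eq_add_of_exact (LinearMap.ker q).subtype q.rangeRestrict
    (Submodule.injective_subtype _) q.surjective_rangeRestrict
    (by rw [LinearMap.exact_iff]; simp)
  rw [e]
  gcongr
  · exact (Module.length_le_of_injective (Submodule.inclusion hker)
      (Submodule.inclusion_injective hker)).trans
      (Module.length_le_of_surjective _ δ.surjective_rangeRestrict)
  · exact Module.length_le_of_injective (LinearMap.range q).subtype (Submodule.injective_subtype _)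

theorem ext_zero : Module.length R (XExt R M Y 0) = Module.length R (M →ₗ[R] Y) := by
  apply LinearEquiv.length_eq
  exact (Abelian.Ext.linearEquiv₀ (R := R)).trans ModuleCat.homLinearEquiv

theorem ext_shift (f : M →ₗ[R] N) (g : N →ₗ[R] L) (hf : Function.Injective f)
    (hg : Function.Surjective g) (hfg : LinearMap.range f = LinearMap.ker g) 
    [Module.Free R N] (hmin : ∀ φ : N →ₗ[R] Y, φ ∘ₗ f = 0) (n : ℕ) :
    Module.length R (XExt R L Y (n+1)) = Module.length R (XExt R M Y n) := by
  have hS := mkSES f g hf hg hfg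
  let δ : XExt R M Y n →ₗ[R] XExt R L Y (n+1) :=
    hS.extClass.precompOfLinear R (ModuleCat.of R Y) (add_comm 1 n)
  have : Projective (ModuleCat.of R N) := ModuleCat.projective_of_free (Module.Free.chooseBasis R N)
  symm
  apply LinearEquiv.length_eq
  refine LinearEquiv.ofBijective δ ⟨?_, ?_⟩
  · rw [← LinearMap.ker_eq_bot, LinearMap.ker_eq_bot']
    intro x hx
    obtain ⟨y, hy⟩ := Abelian.Ext.contravariant_sequence_exact₁ hS (ModuleCat.of R Y) x (add_comm 1 n) hx
    rw [← hy]
    cases n with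
    | zero =>
      obtain ⟨φ, rfl⟩ := Abelian.Ext.homEquiv₀.symm.surjective y
      change (Abelian.Ext.mk₀ _).comp (Abelian.Ext.mk₀ φ) _ = _
      rw [Abelian.Ext.mk₀_comp_mk₀, Abelian.Ext.mk₀_eq_zero_iff]
      ext x
      exact LinearMap.congr_fun (hmin φ.hom) x
    | succ n => 
      rw [Abelian.Ext.eq_zero_of_projective y, Abelian.Ext.comp_zero]
  · intro x
    obtain ⟨y, hy⟩ := Abelian.Ext.contravariant_sequence_exact₃ hS (ModuleCat.of R Y) x
      (by
        exact Abelian.Ext.eq_zero_of_projective (P := ModuleCat.of R N) _) (add_comm 1 n)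
    exact ⟨y, hy⟩

theorem ext_shift_zero (f : M →ₗ[R] N) (g : N →ₗ[R] L) 
    (hg : Function.Surjective g) (hfg : LinearMap.range f = LinearMap.ker g) 
    (hmin : ∀ φ : N →ₗ[R] Y, φ ∘ₗ f = 0) :
    Module.length R (XExt R L Y 0) = Module.length R (XExt R N Y 0) := by
  rw [ext_zero, ext_zero]
  apply LinearEquiv.length_eq
  refine LinearEquiv.ofBijective (LinearMap.lcomp R Y g) ⟨?_, ?_⟩
  · intro a b h
    ext x
    obtain ⟨y, rfl⟩ := hg x
    exact LinearMap.congr_fun h y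
  · intro φ
    have hk : LinearMap.ker g ≤ LinearMap.ker φ := by
      rw [← hfg]
      rintro _ ⟨x, rfl⟩
      exact LinearMap.congr_fun (hmin φ) x
    refine ⟨(LinearMap.ker g).liftQ φ hk ∘ₗ (g.quotKerEquivOfSurjective hg).symm.toLinearMap, ?_⟩
    ext x
    simp only [LinearMap.lcomp_apply, LinearMap.comp_apply, LinearEquiv.coe_coe]
    have : (g.quotKerEquivOfSurjective hg).symm (g x) = Submodule.Quotient.mk x := by
      rw [LinearEquiv.symm_apply_eq]
      rfl
    rw [this]
    rfl

end ExtInterface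

end PS
namespace PS

section Numeric

theorem beta_unbounded (β : ℕ → ℕ) (e r : ℕ) (hr : 2 ≤ r)
    (H2 : ∀ n, e * β (n+1) = β (n+2) + r * β n ∨ ∃ N, ∀ j, β j + 1 ≤ β (N + 1 + j))
    (h0 : β 0 = 1) (h1 : β 1 = e) (B : ℕ) : ∃ n0, ∀ n, n0 ≤ n → B < β n := by
  by_cases hN : ∃ N, ∀ j, β j + 1 ≤ β (N + 1 + j)
  · obtain ⟨N, hN⟩ := hN
    have key : ∀ q n, q * (N + 1) ≤ n → q ≤ β n := by
      intro q
      induction q with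
      | zero => intro n _; exact Nat.zero_le _
      | succ q ih =>
        intro n hn
        have hn' : q * (N + 1) + (N + 1) ≤ n := by linarith [Nat.succ_mul q (N+1)]
        obtain ⟨j, rfl⟩ : ∃ j, n = N + 1 + j := ⟨n - (N+1), by omega⟩
        have := ih j (by omega)
        have := hN j
        omega
    exact ⟨(B + 1) * (N + 1), fun n hn => key (B+1) n hn⟩
  · have H : ∀ n, e * β (n+1) = β (n+2) + r * β n := fun n => (H2 n).resolve_right hN
    have D : ∀ n, (β (n+1) : ℤ)^2 - β (n+2) * β n = r^(n+1) := by
      intro n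
      induction n with
      | zero =>
        have := H 0
        simp only [zero_add, h0, h1] at this ⊢
        have h : (e:ℤ) * e = β 2 + r * 1 := by exact_mod_cast this
        push_cast
        linarith [sq (e:ℤ)]
      | succ n ih =>
        have h : (e:ℤ) * β (n+2) = β (n+3) + r * β (n+1) := by exact_mod_cast H (n+1)
        have h' : (e:ℤ) * β (n+1) = β (n+2) + r * β n := by exact_mod_cast H n
        have : (β (n+1+1) : ℤ)^2 - β (n+1+2) * β (n+1) = r * ((β (n+1) : ℤ)^2 - β (n+2) * β n) := by
          change (β (n+2) : ℤ)^2 - β (n+3) * β (n+1) = _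
          linear_combination (-(β (n+2) : ℤ)) * h' + (β (n+1) : ℤ) * h
        rw [this, ih]
        ring
    refine ⟨B * B + 1, fun n hn => ?_⟩
    obtain ⟨m, rfl⟩ : ∃ m, n = m + 1 := ⟨n - 1, by omega⟩
    have hD := D m
    have h3 : r ^ (m+1) ≤ β (m+1) ^ 2 := by
      have : ((r ^ (m+1) : ℕ) : ℤ) ≤ ((β (m+1) ^ 2 : ℕ) : ℤ) := by
        push_cast
        have : (0:ℤ) ≤ β (m+2) * β m := by positivity
        linarith
      exact_mod_cast this
    have h4 : m + 1 < r ^ (m+1) := Nat.lt_pow_self (by omega)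
    by_contra hlt
    have : β (m+1) ^ 2 ≤ B ^ 2 := Nat.pow_le_pow_left (by omega) 2
    nlinarith

theorem const_of_rec (c : ℕ → ℕ) (e r : ℕ) (hr : 2 ≤ r) (hc : ∀ n, 0 < c n)
    (H : ∀ n, e * c (n+1) = c n + r * c (n+2)) :
    e = r + 1 ∧ ∃ n0, ∀ n, n0 ≤ n → c n = c n0 := by
  have D : ∀ n, (c (n+1) : ℤ)^2 - c n * c (n+2) = r * ((c (n+2) : ℤ)^2 - c (n+1) * c (n+3)) := by
    intro n
    have h : (e:ℤ) * c (n+1) = c n + r * c (n+2) := by exact_mod_cast H n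
    have h' : (e:ℤ) * c (n+2) = c (n+1) + r * c (n+3) := by exact_mod_cast H (n+1)
    linear_combination (c (n+2) : ℤ) * h - (c (n+1) : ℤ) * h'
  have D2 : ∀ m n, (c (n+1) : ℤ)^2 - c n * c (n+2) =
      r^m * ((c (n+m+1) : ℤ)^2 - c (n+m) * c (n+m+2)) := by
    intro m
    induction m with
    | zero => intro n; simp
    | succ m ih =>
      intro n
      rw [ih n, D (n+m), pow_succ]
      rw [show n + m + 3 = n + (m+1) + 2 by ring, show n + m + 2 = n + (m+1) + 1 by ring,
        show n + m + 1 = n + (m+1) by ring]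
      ring
  have D0 : ∀ n, (c (n+1) : ℤ)^2 - c n * c (n+2) = 0 := by
    intro n
    set x := (c (n+1) : ℤ)^2 - c n * c (n+2) with hx
    by_contra hne
    have hd : ((r ^ x.natAbs : ℕ) : ℤ) ∣ x := ⟨_, (D2 x.natAbs n).trans (by push_cast; rfl)⟩
    have := Nat.le_of_dvd (Int.natAbs_pos.2 hne) (Int.natCast_dvd.1 hd)
    have h4 : x.natAbs < r ^ x.natAbs := Nat.lt_pow_self (by omega)
    omega
  have G : ∀ n, c (n+1) ^ 2 = c n * c (n+2) := by
    intro n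
    have := D0 n
    have h : (c (n+1) : ℤ)^2 = c n * c (n+2) := by linarith
    exact_mod_cast h
  have Q : ∀ n, c n ^ 2 + r * c (n+1) ^ 2 = e * c (n+1) * c n := by
    intro n
    rw [G n]
    have := H n
    calc c n ^ 2 + r * (c n * c (n+2)) = c n * (c n + r * c (n+2)) := by ring
      _ = _ := by rw [← this]; ring
  have dv : ∀ n, c (n+1) ∣ c n := by
    intro n
    obtain ⟨g, u, v, hg, hco, hu, hv⟩ := Nat.exists_coprime' (m := c n) (n := c (n+1))
      (Nat.gcd_pos_of_pos_left _ (hc n))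
    have q := Q n
    rw [hu, hv] at q
    have q2 : g ^ 2 * (u ^ 2 + r * v ^ 2) = g ^ 2 * (e * v * u) := by
      linarith [q]
    have q3 : u ^ 2 + r * v ^ 2 = e * v * u := Nat.eq_of_mul_eq_mul_left (by positivity) q2
    have hvd : v ∣ u ^ 2 := by
      have h1 : v ∣ u ^ 2 + r * v ^ 2 := ⟨e * u, by rw [q3]; ring⟩
      have h2 : v ∣ r * v ^ 2 := ⟨r * v, by ring⟩
      exact (Nat.dvd_add_left h2).1 h1
    have : v ∣ 1 := by
      have hc2 : Nat.Coprime v (u ^ 2) := (Nat.Coprime.pow_left 2 hco).symm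
      have := Nat.dvd_gcd dvd_rfl hvd
      rwa [hc2] at this
    have hv1 := Nat.dvd_one.1 this
    rw [hu, hv, hv1]
    exact ⟨u, by ring⟩
  have anti : ∀ n, c (n+1) ≤ c n := fun n => Nat.le_of_dvd (hc n) (dv n)
  have : ∃ n, c (n+1) = c n := by
    by_contra hcon
    push Not at hcon
    have : ∀ n, c n + n ≤ c 0 := by
      intro n
      induction n with
      | zero => simp
      | succ n ih =>
        have := anti n
        have := hcon n
        omega
    have := this (c 0 + 1)
    omega
  obtain ⟨n0, hn0⟩ := this
  have st : ∀ m, c (n0 + m + 1) = c (n0 + m) := by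
    intro m
    induction m with
    | zero => exact hn0
    | succ m ih =>
      have g := G (n0 + m)
      rw [ih, sq] at g
      have := Nat.eq_of_mul_eq_mul_left (hc _) g
      rw [show n0 + (m + 1) + 1 = n0 + m + 2 by ring, show n0 + (m + 1) = n0 + m + 1 by ring, ih]
      exact this.symm
  have cst : ∀ m, c (n0 + m) = c n0 := by
    intro m
    induction m with
    | zero => rfl
    | succ m ih => rw [← ih, ← st m]; rfl
  refine ⟨?_, n0, fun n hn => ?_⟩
  · have := H n0
    rw [cst 1, cst 2] at this
    have h : e * c n0 = (r + 1) * c n0 := by linarith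
    exact Nat.eq_of_mul_eq_mul_right (hc n0) h
  · obtain ⟨m, rfl⟩ := Nat.exists_eq_add_of_le hn
    exact cst m

theorem numeric (c β : ℕ → ℕ) (e r : ℕ) (hr : 2 ≤ r) (hc : ∀ n, 0 < c n)
    (H1 : ∀ n, e * c (n+1) = c n + r * c (n+2) ∨ β (n+1) + 1 ≤ c 0 ∨ β n + 1 ≤ c 0)
    (H2 : ∀ n, e * β (n+1) = β (n+2) + r * β n ∨ ∃ N, ∀ j, β j + 1 ≤ β (N + 1 + j))
    (H3 : ∀ n, e * β (n+1) ≤ β (n+2) + r * β n)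
    (h0 : β 0 = 1) (h1 : β 1 = e)
    (H4 : ∀ n j, j + 1 ≤ n → c n * β (j+1) ≤ c (n-j-1) + r * c (n+1) * β j) (n : ℕ) :
    β n = ∑ j ∈ Finset.range (n+1), r ^ j := by
  obtain ⟨m0, hm0⟩ := beta_unbounded β e r hr H2 h0 h1 (c 0)
  have Hc : ∀ n, e * c (m0 + n+1) = c (m0 + n) + r * c (m0 + n+2) := by
    intro n
    rcases H1 (m0 + n) with h | h | h
    · exact h
    · have := hm0 (m0 + n + 1) (by omega); omega
    · have := hm0 (m0 + n) (by omega); omega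
  obtain ⟨he, n0, hn0⟩ := const_of_rec (fun n => c (m0 + n)) e r hr (fun n => hc _) Hc
  have cst : ∀ n, m0 + n0 ≤ n → c n = c (m0 + n0) := by
    intro n hn
    have := hn0 (n - m0) (by omega)
    simpa [show m0 + (n - m0) = n by omega] using this
  have up : ∀ j, β (j+1) ≤ 1 + r * β j := by
    intro j
    have := H4 (m0 + n0 + j + 1) j (by omega)
    rw [cst _ (by omega), cst (m0 + n0 + j + 1 - j - 1) (by omega),
      cst (m0 + n0 + j + 1 + 1) (by omega)] at this
    have h : c (m0 + n0) * β (j+1) ≤ c (m0 + n0) * (1 + r * β j) := by linarith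
    exact Nat.le_of_mul_le_mul_left h (hc _)
  have low : ∀ n, β n + r ^ (n+1) ≤ β (n+1) := by
    intro n
    induction n with
    | zero => rw [h0, h1, he]; simp; omega
    | succ n ih =>
      have := H3 n
      rw [he] at this
      have h5 : r * (β n + r ^ (n+1)) ≤ r * β (n+1) := Nat.mul_le_mul_left _ ih
      have : r ^ (n+1+1) = r * r ^ (n+1) := by ring
      change β (n+1) + r ^ (n+1+1) ≤ β (n+2)
      nlinarith
  have S : ∀ n, ∑ j ∈ Finset.range (n+1+1), r ^ j = 1 + r * ∑ j ∈ Finset.range (n+1), r ^ j := by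
    intro n
    rw [Finset.sum_range_succ', Finset.mul_sum]
    simp [pow_succ', add_comm]
  induction n with
  | zero => simp [h0]
  | succ n ih =>
    apply le_antisymm
    · rw [S, ← ih]; exact up n
    · rw [Finset.sum_range_succ, ← ih]; exact low n

end Numeric

end PS
namespace PS

section LocalAlg

open TensorProduct

variable {R : Type} [CommRing R] [IsLocalRing R]
variable {M N F : Type} [AddCommGroup M] [Module R M] [AddCommGroup N] [Module R N]
  [AddCommGroup F] [Module R F]

/-- Minimal free cover. -/
theorem exists_cover (R : Type) [CommRing R] [IsLocalRing R] (M : Type) [AddCommGroup M]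
    [Module R M] [Module.Finite R M] :
    ∃ (c : ℕ) (π : (Fin c → R) →ₗ[R] M), Function.Surjective π ∧
      LinearMap.ker π ≤ maximalIdeal R • ⊤ := by
  let w := Module.finBasis (ResidueField R) (ResidueField R ⊗[R] M)
  obtain ⟨v, eq⟩ := (TensorProduct.mk_surjective R M (ResidueField R)
    Ideal.Quotient.mk_surjective).comp_left w
  have hsp := IsLocalRing.span_eq_top_of_tmul_eq_basis v w (congr_fun eq)
  refine ⟨_, Fintype.linearCombination R v, ?_, ?_⟩
  · rw [← LinearMap.range_eq_top, Fintype.range_linearCombination, hsp]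
  · intro x hx
    rw [LinearMap.mem_ker, Fintype.linearCombination_apply] at hx
    have h1 : ∑ i, residue R (x i) • w i = 0 := by
      have := congrArg (TensorProduct.mk R (ResidueField R) M 1) hx
      rw [map_sum, map_zero] at this
      rw [← this]
      refine Finset.sum_congr rfl fun i _ => ?_
      rw [map_smul, ← congr_fun eq i]
      rfl
    have h2 := Fintype.linearIndependent_iff.1 w.linearIndependent _ h1
    rw [pi_eq_sum_univ' x]
    refine Submodule.sum_mem _ fun i _ => ?_
    exact Submodule.smul_mem_smul ((residue_eq_zero_iff _).1 (h2 i)) trivial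

/-- Functionals to the residue field kill the maximal ideal times the module. -/
theorem hom_kills (φ : M →ₗ[R] ResidueField R) :
    maximalIdeal R • (⊤ : Submodule R M) ≤ LinearMap.ker φ := by
  rw [Submodule.smul_le]
  intro a ha x _
  rw [LinearMap.mem_ker, map_smul, Algebra.smul_def]
  have : algebraMap R (ResidueField R) a = 0 := (residue_eq_zero_iff a).2 ha
  rw [this, zero_mul]

theorem length_k : Module.length R (ResidueField R) = 1 := by
  rw [Module.length_eq_one_iff]
  have : IsSimpleModule R (R ⧸ maximalIdeal R) := isSimpleModule_iff_isCoatom.2 (maximalIdeal.isMaximal R).out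
  exact this

theorem length_hom_free [Module.Free R F] [Module.Finite R F] :
    Module.length R (F →ₗ[R] ResidueField R) = Module.finrank R F := by
  rw [((Module.finBasis R F).constr R).symm.length_eq, Module.length_pi, length_k]
  simp

theorem cover_shift [Module.Free R F] (π : F →ₗ[R] M) (hs : Function.Surjective π)
    (hk : LinearMap.ker π ≤ maximalIdeal R • ⊤) (n : ℕ) :
    Module.length R (XExt R M (ResidueField R) (n+1)) =
      Module.length R (XExt R (LinearMap.ker π) (ResidueField R) n) := by
  refine ext_shift (LinearMap.ker π).subtype π (Submodule.injective_subtype _) hs (by simp)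
    (fun φ => ?_) n
  ext x
  exact hom_kills φ (hk x.2)

theorem cover_zero [Module.Free R F] [Module.Finite R F] (π : F →ₗ[R] M)
    (hs : Function.Surjective π)
    (hk : LinearMap.ker π ≤ maximalIdeal R • ⊤) :
    Module.length R (XExt R M (ResidueField R) 0) = Module.finrank R F := by
  rw [ext_shift_zero (LinearMap.ker π).subtype π hs (by simp)
    (fun φ => by ext x; exact hom_kills φ (hk x.2)), ext_zero, length_hom_free]

end LocalAlg

end PS
namespace PS

set_option linter.unusedSectionVars false

section Len

variable (R : Type) [CommRing R]

/-- length as a natural number -/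
noncomputable def len (M : Type) [AddCommGroup M] [Module R M] : ℕ := (Module.length R M).toNat

/-- Betti numbers as natural numbers -/
noncomputable def bet [IsLocalRing R] (M : Type) [AddCommGroup M] [Module R M] (n : ℕ) : ℕ :=
  (Module.length R (XExt R M (ResidueField R) n)).toNat

variable {R}
variable {M N F : Type} [AddCommGroup M] [Module R M] [AddCommGroup N] [Module R N]
  [AddCommGroup F] [Module R F]

theorem coe_len [IsArtinianRing R] [Module.Finite R M] : (len R M : ℕ∞) = Module.length R M := by
  rw [len, ENat.natCast_toNat]
  exact Module.length_ne_top

theorem len_congr (e : M ≃ₗ[R] N) : len R M = len R N := by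
  rw [len, len, e.length_eq]

variable [IsArtinianRing R]

theorem len_map_add [Module.Finite R F] (π : F →ₗ[R] M) (P : Submodule R F)
    (h : LinearMap.ker π ≤ P) : len R P = len R (P.map π) + len R (LinearMap.ker π) := by
  have := Module.length_eq_add_of_exact (Submodule.inclusion h) (π.submoduleMap P)
    (Submodule.inclusion_injective h) (π.submoduleMap_surjective P) (by
      rw [LinearMap.exact_iff]
      ext x
      simp only [LinearMap.mem_ker, LinearMap.mem_range]
      constructor
      · intro hx
        have h2 : π x = 0 := congrArg Subtype.val hx
        exact ⟨⟨x, h2⟩, rfl⟩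
      · rintro ⟨y, rfl⟩
        apply Subtype.ext
        exact y.2)
  rw [← coe_len, ← coe_len, ← coe_len] at this
  have h3 : len R P = len R (LinearMap.ker π) + len R (P.map π) := by exact_mod_cast this
  omega

theorem len_top (M : Type) [AddCommGroup M] [Module R M] :
    len R (⊤ : Submodule R M) = len R M := len_congr Submodule.topEquiv

theorem len_add [Module.Finite R F] (π : F →ₗ[R] M) (hs : Function.Surjective π) :
    len R F = len R M + len R (LinearMap.ker π) := by
  have := len_map_add π ⊤ le_top
  rwa [Submodule.map_top, LinearMap.range_eq_top.2 hs, len_top, len_top] at this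

theorem len_mono [Module.Finite R M] {P Q : Submodule R M} (h : P ≤ Q) : len R P ≤ len R Q := by
  have := Module.length_le_of_injective (Submodule.inclusion h) (Submodule.inclusion_injective h)
  rw [← coe_len, ← coe_len] at this
  exact_mod_cast this

theorem eq_of_len [Module.Finite R M] {P Q : Submodule R M} (h : P ≤ Q) (h2 : len R Q ≤ len R P) :
    P = Q := by
  by_contra hne
  have := Submodule.height_strictMono (lt_of_le_of_ne h hne)
  rw [← Module.length_submodule, ← Module.length_submodule, ← coe_len, ← coe_len] at this
  have : len R P < len R Q := by exact_mod_cast this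
  omega

theorem len_eq_zero [Module.Finite R M] : len R M = 0 ↔ Subsingleton M := by
  rw [← Module.length_eq_zero_iff (R := R), ← coe_len]
  simp

theorem len_sub_eq_zero [Module.Finite R M] (P : Submodule R M) : len R P = 0 ↔ P = ⊥ := by
  rw [len_eq_zero, Submodule.subsingleton_iff_eq_bot]

theorem smul_top_map (I : Ideal R) (K : Submodule R M) :
    (I • (⊤ : Submodule R K)).map K.subtype = I • K := by
  rw [Submodule.map_smul'', Submodule.map_top, Submodule.range_subtype]

theorem len_smul_top (I : Ideal R) (K : Submodule R M) :
    len R (I • (⊤ : Submodule R K) : Submodule R K) = len R (I • K : Submodule R M) := by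
  rw [← smul_top_map I K]
  exact len_congr (Submodule.equivMapOfInjective _ (Submodule.injective_subtype K) _)

theorem len_free_smul [Module.Free R F] [Module.Finite R F] [Nontrivial R] (I : Ideal R) :
    len R (I • (⊤ : Submodule R F) : Submodule R F) = len R I * Module.finrank R F := by
  let b := Module.finBasis R F
  let f : (Fin (Module.finrank R F) → I) →ₗ[R] F :=
    Fintype.linearCombination R b ∘ₗ LinearMap.compLeft I.subtype _
  have hf : Function.Injective f := by
    have h1 : Function.Injective (Fintype.linearCombination R b) :=
      linearIndependent_iff_injective_fintypeLinearCombination.1 b.linearIndependent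
    refine h1.comp ?_
    intro x y h
    ext i
    exact congr_fun h i
  have hr : LinearMap.range f = I • (⊤ : Submodule R F) := by
    apply le_antisymm
    · rintro _ ⟨x, rfl⟩
      change Fintype.linearCombination R b _ ∈ _
      rw [Fintype.linearCombination_apply]
      refine Submodule.sum_mem _ fun i _ => ?_
      exact Submodule.smul_mem_smul (x i).2 trivial
    · rw [Submodule.smul_le]
      intro a ha x _
      refine ⟨fun i => ⟨a * b.repr x i, I.mul_mem_right _ ha⟩, ?_⟩
      change Fintype.linearCombination R b _ = _
      rw [Fintype.linearCombination_apply]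
      conv_rhs => rw [← b.sum_repr x, Finset.smul_sum]
      refine Finset.sum_congr rfl fun i _ => ?_
      rw [smul_smul]
      rfl
  rw [← hr, ← len_congr (LinearEquiv.ofInjective f hf)]
  have := Module.length_pi (R := R) (M := I) (ι := Fin (Module.finrank R F))
  rw [← coe_len, ← coe_len, ENat.card_eq_coe_fintype_card, Fintype.card_fin] at this
  rw [mul_comm]
  exact_mod_cast this

theorem len_free [Module.Free R F] [Module.Finite R F] [Nontrivial R] :
    len R F = len R R * Module.finrank R F := by
  have := len_free_smul (R := R) (F := F) ⊤
  rwa [Submodule.top_smul, len_top, len_top] at this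

end Len

section Bet

variable {R : Type} [CommRing R] [IsLocalRing R] [IsArtinianRing R]
variable {M N F : Type} [AddCommGroup M] [Module R M] [AddCommGroup N] [Module R N]
  [AddCommGroup F] [Module R F]

theorem bet_top (n : ℕ) : ∀ (M : Type) [AddCommGroup M] [Module R M] [Module.Finite R M],
    Module.length R (XExt R M (ResidueField R) n) ≠ ⊤ := by
  induction n with
  | zero =>
    intro M _ _ _
    obtain ⟨c, π, hs, hk⟩ := exists_cover R M
    rw [cover_zero π hs hk]
    simp
  | succ n ih =>
    intro M _ _ _
    obtain ⟨c, π, hs, hk⟩ := exists_cover R M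
    rw [cover_shift π hs hk]
    exact ih _

theorem coe_bet [Module.Finite R M] (n : ℕ) :
    (bet R M n : ℕ∞) = Module.length R (XExt R M (ResidueField R) n) :=
  ENat.natCast_toNat (bet_top n M)

theorem bet_succ [Module.Free R F] (π : F →ₗ[R] M) (hs : Function.Surjective π)
    (hk : LinearMap.ker π ≤ maximalIdeal R • ⊤) (n : ℕ) :
    bet R M (n+1) = bet R (LinearMap.ker π) n := by
  rw [bet, bet, cover_shift π hs hk]

theorem bet_zero [Module.Free R F] [Module.Finite R F] (π : F →ₗ[R] M)
    (hs : Function.Surjective π)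
    (hk : LinearMap.ker π ≤ maximalIdeal R • ⊤) : bet R M 0 = Module.finrank R F := by
  rw [bet, cover_zero π hs hk]
  simp

theorem bet_congr (e : M ≃ₗ[R] N) (n : ℕ) : bet R M n = bet R N n := by
  rw [bet, bet, ext_congr e]

theorem len_k : len R (ResidueField R) = 1 := by
  rw [len, length_k]; rfl

theorem len_R : len R R = 1 + len R (maximalIdeal R) := by
  have := len_add (R := R) (Algebra.linearMap R (ResidueField R)) residue_surjective
  rw [this, len_k]
  congr 1
  have : LinearMap.ker (Algebra.linearMap R (ResidueField R)) = maximalIdeal R := by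
    ext x
    exact residue_eq_zero_iff x
  rw [this]

theorem len_smul_map (π : F →ₗ[R] M) (hs : Function.Surjective π) (I : Ideal R) :
    (I • (⊤ : Submodule R F)).map π = I • ⊤ := by
  rw [Submodule.map_smul'', Submodule.map_top, LinearMap.range_eq_top.2 hs]

/-- length equals number of generators plus length of the radical. -/
theorem nu_add [Module.Finite R M] :
    len R M = bet R M 0 + len R (maximalIdeal R • (⊤ : Submodule R M) : Submodule R M) := by
  obtain ⟨c, π, hs, hk⟩ := exists_cover R M
  have h1 := len_add π hs
  have h2 := len_map_add π _ hk
  rw [len_smul_map π hs, len_free_smul] at h2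
  rw [len_free, len_R] at h1
  rw [bet_zero π hs hk]
  nlinarith

theorem bet_killed [Module.Finite R N] (h : maximalIdeal R • (⊤ : Submodule R N) = ⊥) (n : ℕ) :
    bet R N n = len R N * bet R (ResidueField R) n := by
  obtain ⟨c, π, hs, hk⟩ := exists_cover R N
  let ρ : (Fin c → R) →ₗ[R] (Fin c → ResidueField R) :=
    LinearMap.compLeft (Algebra.linearMap R (ResidueField R)) _
  have hρ : Function.Surjective ρ := by
    intro y
    choose x hx using fun i => residue_surjective (R := R) (y i)
    exact ⟨x, funext hx⟩
  have hker : LinearMap.ker π = LinearMap.ker ρ := by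
    apply le_antisymm
    · refine hk.trans ?_
      rw [Submodule.smul_le]
      intro a ha x _
      rw [LinearMap.mem_ker]
      ext i
      change algebraMap R (ResidueField R) (a * x i) = 0
      rw [map_mul]
      have : algebraMap R (ResidueField R) a = 0 := (residue_eq_zero_iff a).2 ha
      rw [this, zero_mul]
    · intro x hx
      have hx2 : x ∈ maximalIdeal R • (⊤ : Submodule R (Fin c → R)) := by
        rw [pi_eq_sum_univ' x]
        refine Submodule.sum_mem _ fun i _ => ?_
        exact Submodule.smul_mem_smul ((residue_eq_zero_iff _).1 (congr_fun hx i)) trivial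
      have := Submodule.mem_map_of_mem (f := π) hx2
      rw [len_smul_map π hs, h] at this
      exact this
  let e : N ≃ₗ[R] (Fin c → ResidueField R) :=
    (π.quotKerEquivOfSurjective hs).symm.trans
      ((Submodule.quotEquivOfEq _ _ hker).trans (ρ.quotKerEquivOfSurjective hρ))
  have hl : len R N = c := by
    rw [len_congr e, len, Module.length_pi, length_k]
    simp
  rw [hl, bet_congr e]
  have := ext_pi (R := R) (M := ResidueField R) (Y := ResidueField R) c n
  rw [← coe_bet, ← coe_bet] at this
  exact_mod_cast this

/-- the basic identity -/
theorem basic_id [Module.Free R F] [Module.Finite R F] (π : F →ₗ[R] M)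
    (hs : Function.Surjective π) (hk : LinearMap.ker π ≤ maximalIdeal R • ⊤) :
    bet R M 1 + len R (maximalIdeal R • (⊤ : Submodule R M) : Submodule R M)
      + len R (maximalIdeal R • LinearMap.ker π : Submodule R F)
      = len R (maximalIdeal R) * bet R M 0 := by
  have h2 := len_map_add π _ hk
  rw [len_smul_map π hs, len_free_smul] at h2
  have h3 := nu_add (R := R) (M := LinearMap.ker π)
  rw [len_smul_top] at h3
  rw [bet_zero π hs hk, bet_succ π hs hk 0]
  omega

/-- length of the radical of the syzygy -/
theorem len_rad_le [Module.Free R F] [Module.Finite R F] (K : Submodule R F)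
    (hk : K ≤ maximalIdeal R • ⊤) :
    len R (maximalIdeal R • K : Submodule R F) ≤
      len R (maximalIdeal R ^ 2 : Ideal R) * Module.finrank R F := by
  rw [← len_free_smul]
  apply len_mono
  rw [pow_two, Submodule.mul_smul]
  exact Submodule.smul_mono le_rfl hk

theorem bet_k_zero : bet R (ResidueField R) 0 = 1 := by
  have := bet_zero (R := R) (Algebra.linearMap R (ResidueField R)) residue_surjective (by
    intro x hx
    have : x ∈ maximalIdeal R := (residue_eq_zero_iff x).1 hx
    have h := Submodule.smul_mem_smul this (Submodule.mem_top (x := (1:R)))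
    simpa using h)
  rw [this, Module.finrank_self]

theorem len_m : len R (maximalIdeal R) =
    bet R (ResidueField R) 1 + len R (maximalIdeal R ^ 2 : Ideal R) := by
  have hker : LinearMap.ker (Algebra.linearMap R (ResidueField R)) = maximalIdeal R := by
    ext x
    exact residue_eq_zero_iff x
  have := basic_id (R := R) (Algebra.linearMap R (ResidueField R)) residue_surjective (by
    rw [hker]; simp)
  rw [hker, bet_k_zero] at this
  have h0 : maximalIdeal R • (⊤ : Submodule R (ResidueField R)) = ⊥ := by
    rw [eq_bot_iff]
    exact hom_kills LinearMap.id
  rw [h0, (len_sub_eq_zero _).2 rfl] at this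
  rw [pow_two]
  simpa using this.symm

end Bet

end PS
namespace PS

section Summand

variable {R : Type} [CommRing R] [IsLocalRing R] [IsArtinianRing R]
variable {M N F : Type} [AddCommGroup M] [Module R M] [AddCommGroup N] [Module R N]
  [AddCommGroup F] [Module R F]

theorem exists_functional [Module.Finite R M] (x : M)
    (hx : x ∉ maximalIdeal R • (⊤ : Submodule R M)) :
    ∃ f : M →ₗ[R] ResidueField R, f x = 1 := by
  obtain ⟨c, π, hs, hk⟩ := exists_cover R M
  obtain ⟨y, rfl⟩ := hs x
  have hy : ∃ i, y i ∉ maximalIdeal R := by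
    by_contra hcon
    push Not at hcon
    apply hx
    rw [← len_smul_map π hs]
    apply Submodule.mem_map_of_mem
    rw [pi_eq_sum_univ' y]
    refine Submodule.sum_mem _ fun i _ => ?_
    exact Submodule.smul_mem_smul (hcon i) trivial
  obtain ⟨i, hi⟩ := hy
  let φ : (Fin c → R) →ₗ[R] ResidueField R :=
    Algebra.linearMap R (ResidueField R) ∘ₗ LinearMap.proj i
  have hφ : LinearMap.ker π ≤ LinearMap.ker φ := hk.trans (hom_kills φ)
  let f : M →ₗ[R] ResidueField R :=
    (LinearMap.ker π).liftQ φ hφ ∘ₗ (π.quotKerEquivOfSurjective hs).symm.toLinearMap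
  have hf : f (π y) = residue R (y i) := by
    change (LinearMap.ker π).liftQ φ hφ ((π.quotKerEquivOfSurjective hs).symm (π y)) = _
    have : (π.quotKerEquivOfSurjective hs).symm (π y) = Submodule.Quotient.mk y := by
      rw [LinearEquiv.symm_apply_eq]
      rfl
    rw [this]
    rfl
  have hu : IsUnit (y i) := by
    by_contra h
    exact hi h
  obtain ⟨u, hu⟩ := hu
  refine ⟨(↑(u⁻¹) : R) • f, ?_⟩
  rw [LinearMap.smul_apply, hf, ← hu, Algebra.smul_def]
  change residue R _ * residue R _ = 1
  rw [← map_mul]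
  simp

theorem split_off [Module.Finite R M] (x : M) (hx : x ∉ maximalIdeal R • (⊤ : Submodule R M))
    (hx0 : ∀ a ∈ maximalIdeal R, a • x = 0) :
    ∃ W : Submodule R M, len R M = 1 + len R W ∧
      ∀ n, bet R M n = bet R (ResidueField R) n + bet R W n := by
  obtain ⟨f, hf⟩ := exists_functional x hx
  let g : ResidueField R →ₗ[R] M :=
    (maximalIdeal R).liftQ (LinearMap.toSpanSingleton R M x) (by
      intro a ha
      rw [LinearMap.mem_ker, LinearMap.toSpanSingleton_apply]
      exact hx0 a ha)
  have hg : ∀ a : R, g (residue R a) = a • x := fun a => rfl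
  have hfg : ∀ z, f (g z) = z := by
    intro z
    obtain ⟨a, rfl⟩ := residue_surjective z
    rw [hg, map_smul, hf, Algebra.smul_def, mul_one]
    rfl
  refine ⟨LinearMap.ker f, ?_, fun n => ?_⟩
  · have := len_add f (fun z => ⟨g z, hfg z⟩)
    rwa [len_k] at this
  · let q : M →ₗ[R] LinearMap.ker f := (LinearMap.id - g ∘ₗ f).codRestrict _ (by
      intro z
      simp [hfg])
    have := ext_split (Y := ResidueField R) g f (LinearMap.ker f).subtype q
      (by ext; simp [hfg]) (by ext z; simp [q])
      (by ext z; simp) (by ext; simp [q, hfg]) (by ext z; simp [q]) n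
    rw [← coe_bet, ← coe_bet, ← coe_bet] at this
    exact_mod_cast this

theorem ker_facts [Module.Free R F] [Module.Finite R F] (h3 : maximalIdeal R ^ 3 = ⊥)
    (K : Submodule R F) (hk : K ≤ maximalIdeal R • ⊤) :
    maximalIdeal R ^ 2 • K = ⊥ := by
  rw [eq_bot_iff]
  refine (Submodule.smul_mono le_rfl hk).trans ?_
  rw [← Submodule.mul_smul, ← pow_succ, h3, Submodule.bot_smul]

theorem smul_top_bot (I : Ideal R) (K : Submodule R M) (h : I • K = ⊥) :
    I • (⊤ : Submodule R K) = ⊥ := by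
  have := smul_top_map I K
  exact Submodule.map_injective_of_injective (Submodule.injective_subtype K)
    ((this.trans h).trans (Submodule.map_bot _).symm)

theorem le_ker (π : F →ₗ[R] M) (hs : Function.Surjective π)
    (hM : maximalIdeal R ^ 2 • (⊤ : Submodule R M) = ⊥) :
    maximalIdeal R ^ 2 • (⊤ : Submodule R F) ≤ LinearMap.ker π := by
  intro x hx
  have := Submodule.mem_map_of_mem (f := π) hx
  rw [len_smul_map π hs, hM] at this
  exact this

theorem bet_zero_pos [Module.Finite R M] [Nontrivial M]
    (hM : maximalIdeal R ^ 2 • (⊤ : Submodule R M) = ⊥) : 1 ≤ bet R M 0 := by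
  by_contra hcon
  have h := nu_add (R := R) (M := M)
  have h1 : maximalIdeal R • (⊤ : Submodule R M) = ⊤ :=
    eq_of_len le_top (by rw [len_top]; omega)
  rw [pow_two, Submodule.mul_smul, h1, h1] at hM
  exact bot_ne_top hM.symm

theorem bet_pos (h3 : maximalIdeal R ^ 3 = ⊥) (h2 : maximalIdeal R ^ 2 ≠ ⊥) (n : ℕ) :
    ∀ (M : Type) [AddCommGroup M] [Module R M] [Module.Finite R M] [Nontrivial M],
    maximalIdeal R ^ 2 • (⊤ : Submodule R M) = ⊥ → 1 ≤ bet R M n := by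
  induction n with
  | zero =>
    intro M _ _ _ _ hM
    exact bet_zero_pos hM
  | succ n ih =>
    intro M _ _ _ _ hM
    obtain ⟨c, π, hs, hk⟩ := exists_cover R M
    rw [bet_succ π hs hk]
    have hc : 1 ≤ Module.finrank R (Fin c → R) := by
      rw [← bet_zero π hs hk]
      exact bet_zero_pos hM
    have hne : LinearMap.ker π ≠ ⊥ := by
      intro h0
      have h4 := le_ker π hs hM
      rw [h0, le_bot_iff, ← len_sub_eq_zero, len_free_smul] at h4
      have : len R (maximalIdeal R ^ 2 : Ideal R) ≠ 0 := fun h => h2 ((len_sub_eq_zero _).1 h)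
      rcases Nat.mul_eq_zero.1 h4 with h | h
      · exact this h
      · omega
    have : Nontrivial (LinearMap.ker π) := (Submodule.nontrivial_iff_ne_bot).2 hne
    exact ih _ (smul_top_bot _ _ (ker_facts h3 _ hk))

theorem lemmaB (h3 : maximalIdeal R ^ 3 = ⊥) (h2 : maximalIdeal R ^ 2 ≠ ⊥)
    (hh : 2 ≤ len R (maximalIdeal R ^ 2 : Ideal R))
    [Module.Free R F] [Module.Finite R F] (π : F →ₗ[R] M)
    (hs : Function.Surjective π) (hk : LinearMap.ker π ≤ maximalIdeal R • ⊤)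
    (hM : maximalIdeal R ^ 2 • (⊤ : Submodule R M) = ⊥) :
    len R (maximalIdeal R • LinearMap.ker π : Submodule R F) =
      len R (maximalIdeal R ^ 2 : Ideal R) * bet R M 0 ∨
    ∀ n, bet R (ResidueField R) n + 1 ≤ bet R (LinearMap.ker π) n := by
  rw [bet_zero π hs hk, ← len_free_smul]
  set K := LinearMap.ker π with hK
  have hle : maximalIdeal R ^ 2 • (⊤ : Submodule R F) ≤ K := le_ker π hs hM
  have hle2 : maximalIdeal R • K ≤ maximalIdeal R ^ 2 • (⊤ : Submodule R F) := by
    rw [pow_two, Submodule.mul_smul]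
    exact Submodule.smul_mono le_rfl hk
  by_cases hcase : maximalIdeal R ^ 2 • (⊤ : Submodule R F) ≤ maximalIdeal R • K
  · left
    rw [le_antisymm hle2 hcase]
  · right
    obtain ⟨x, hx1, hx2⟩ := SetLike.not_le_iff_exists.1 hcase
    have hx3 : (⟨x, hle hx1⟩ : K) ∉ maximalIdeal R • (⊤ : Submodule R K) := by
      intro h
      apply hx2
      rw [← smul_top_map]
      exact Submodule.mem_map_of_mem (f := K.subtype) h
    have hx4 : ∀ a ∈ maximalIdeal R, a • (⟨x, hle hx1⟩ : K) = 0 := by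
      intro a ha
      apply Subtype.ext
      have := Submodule.smul_mem_smul ha hx1
      rw [← Submodule.mul_smul, ← pow_succ', h3, Submodule.bot_smul] at this
      exact this
    obtain ⟨W, hW1, hW2⟩ := split_off _ hx3 hx4
    intro n
    rw [hW2 n]
    have hKlen : 2 ≤ len R K := by
      have h4 := len_mono hle
      rw [len_free_smul] at h4
      have h5 : Module.finrank R F ≠ 0 := by
        intro h0
        have := len_free_smul (R := R) (F := F) (maximalIdeal R ^ 2)
        rw [h0, mul_zero, len_sub_eq_zero] at this
        rw [this] at hcase
        exact hcase bot_le
      have : 1 ≤ Module.finrank R F := Nat.one_le_iff_ne_zero.2 h5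
      nlinarith
    have : Nontrivial W := by
      by_contra hW
      rw [not_nontrivial_iff_subsingleton, ← len_eq_zero (R := R)] at hW
      omega
    have hW3 : maximalIdeal R ^ 2 • (⊤ : Submodule R W) = ⊥ := by
      apply smul_top_bot
      rw [eq_bot_iff]
      refine (Submodule.smul_mono le_rfl (le_top : W ≤ ⊤)).trans ?_
      rw [smul_top_bot _ _ (ker_facts h3 K hk)]
    have := bet_pos h3 h2 n W hW3
    omega

theorem rec_le (n : ℕ) : ∀ (M : Type) [AddCommGroup M] [Module R M] [Module.Finite R M],
    bet R (ResidueField R) 1 * bet R M (n+1) ≤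
      bet R M (n+2) + len R (maximalIdeal R ^ 2 : Ideal R) * bet R M n := by
  induction n with
  | zero =>
    intro M _ _ _
    obtain ⟨c, π, hs, hk⟩ := exists_cover R M
    obtain ⟨c', π', hs', hk'⟩ := exists_cover R (LinearMap.ker π)
    have h1 := basic_id π' hs' hk'
    have h2 := len_rad_le _ hk
    have h3 := len_rad_le _ hk'
    rw [← bet_zero π hs hk] at h2
    rw [← bet_zero π' hs' hk'] at h3
    rw [len_smul_top, len_m] at h1
    rw [← bet_succ π hs hk, ← bet_succ π hs hk] at h1
    rw [← bet_succ π hs hk] at h3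
    simp only [zero_add] at h1 h3 ⊢
    nlinarith
  | succ n ih =>
    intro M _ _ _
    obtain ⟨c, π, hs, hk⟩ := exists_cover R M
    rw [bet_succ π hs hk, bet_succ π hs hk (n+2), bet_succ π hs hk n]
    exact ih _

theorem lemmaC (h3 : maximalIdeal R ^ 3 = ⊥) (h2 : maximalIdeal R ^ 2 ≠ ⊥)
    (hh : 2 ≤ len R (maximalIdeal R ^ 2 : Ideal R)) (n : ℕ) :
    ∀ (M : Type) [AddCommGroup M] [Module R M] [Module.Finite R M],
    maximalIdeal R ^ 2 • (⊤ : Submodule R M) = ⊥ →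
    bet R (ResidueField R) 1 * bet R M (n+1) =
      bet R M (n+2) + len R (maximalIdeal R ^ 2 : Ideal R) * bet R M n ∨
    (∀ j, bet R (ResidueField R) j + 1 ≤ bet R M (n + 1 + j)) ∨
    (∀ j, bet R (ResidueField R) j + 1 ≤ bet R M (n + 1 + 1 + j)) := by
  induction n with
  | zero =>
    intro M _ _ _ hM
    obtain ⟨c, π, hs, hk⟩ := exists_cover R M
    obtain ⟨c', π', hs', hk'⟩ := exists_cover R (LinearMap.ker π)
    have h1 := basic_id π' hs' hk'
    rw [len_smul_top, len_m] at h1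
    rcases lemmaB h3 h2 hh π hs hk hM with h5 | h5
    · rcases lemmaB h3 h2 hh π' hs' hk' (smul_top_bot _ _ (ker_facts h3 _ hk)) with h6 | h6
      · left
        rw [← bet_succ π hs hk] at h6
        rw [← bet_succ π hs hk, ← bet_succ π hs hk] at h1
        simp only [zero_add] at h1 h6 ⊢
        nlinarith
      · right; right
        intro j
        have := h6 j
        rw [← bet_succ π' hs' hk', ← bet_succ π hs hk] at this
        rwa [show 0 + 1 + 1 + j = j + 1 + 1 by ring]
    · right; left
      intro j
      have := h5 j
      rw [← bet_succ π hs hk] at this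
      rwa [show 0 + 1 + j = j + 1 by ring]
  | succ n ih =>
    intro M _ _ _ hM
    obtain ⟨c, π, hs, hk⟩ := exists_cover R M
    have := ih _ (smul_top_bot _ _ (ker_facts h3 _ hk))
    simp only [← bet_succ π hs hk] at this
    have e1 : ∀ j, n + 1 + j + 1 = n + 1 + 1 + j := fun j => by ring
    have e2 : ∀ j, n + 1 + 1 + j + 1 = n + 1 + 1 + 1 + j := fun j => by ring
    simp only [e1, e2] at this
    exact this

end Summand

end PS
namespace PS

section Complex

variable {R : Type} [CommRing R] [IsLocalRing R] [IsArtinianRing R]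

theorem rad_ineq {M : Type} [AddCommGroup M] [Module R M] [Module.Finite R M]
    (hM : maximalIdeal R ^ 2 • (⊤ : Submodule R M) = ⊥) (j : ℕ) :
    bet R M 0 * bet R (ResidueField R) (j+1) ≤
      len R (maximalIdeal R • (⊤ : Submodule R M) : Submodule R M) * bet R (ResidueField R) j
        + bet R M (j+1) := by
  let P : Submodule R M := maximalIdeal R • ⊤
  have h := ext_middle (Y := ResidueField R) P.subtype P.mkQ (Submodule.injective_subtype _)
    (Submodule.mkQ_surjective _) (by simp) j
  rw [← coe_bet, ← coe_bet, ← coe_bet] at h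
  have h' : bet R (M ⧸ P) (j+1) ≤ bet R P j + bet R M (j+1) := by exact_mod_cast h
  have k1 : maximalIdeal R • (⊤ : Submodule R P) = ⊥ := by
    apply smul_top_bot
    rw [← Submodule.mul_smul, ← pow_two, hM]
  have k2 : maximalIdeal R • (⊤ : Submodule R (M ⧸ P)) = ⊥ := by
    rw [← len_smul_map P.mkQ (Submodule.mkQ_surjective _)]
    exact Submodule.mkQ_map_self P
  rw [bet_killed k1, bet_killed k2] at h'
  have h5 := len_add P.mkQ (Submodule.mkQ_surjective _)
  rw [Submodule.ker_mkQ] at h5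
  have h6 := nu_add (R := R) (M := M)
  have h7 : len R (M ⧸ P) = bet R M 0 := by
    change len R M = bet R M 0 + len R P at h6
    omega
  rw [h7] at h'
  exact h'

theorem sq_le_socle (h3 : maximalIdeal R ^ 3 = ⊥) : maximalIdeal R ^ 2 ≤ socle R := by
  intro x hx
  rw [socle, Submodule.mem_colon]
  intro p hp
  rw [← h3, pow_succ]
  exact Ideal.mul_mem_mul hx hp

theorem socle_mul : socle R * maximalIdeal R = ⊥ := by
  rw [eq_bot_iff, Ideal.mul_le]
  intro s hs a ha
  rw [socle, Submodule.mem_colon] at hs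
  exact hs a ha

variable (A : ℤ → Type) [∀ i, AddCommGroup (A i)] [∀ i, Module R (A i)]
  [hfree : ∀ i, Module.Free R (A i)] [hfin : ∀ i, Module.Finite R (A i)]
  (d : ∀ i : ℤ, A (i + 1) →ₗ[R] A i)

theorem cover_ok
    (hacyclic : ∀ i, LinearMap.range (d (i + 1)) = LinearMap.ker (d i))
    (hmin : ∀ i, LinearMap.range (d i) ≤ maximalIdeal R • (⊤ : Submodule R (A i)))
    (i : ℤ) : LinearMap.ker (d i).rangeRestrict ≤ maximalIdeal R • ⊤ := by
  rw [LinearMap.ker_rangeRestrict, ← hacyclic]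
  exact hmin _

theorem bet_range
    (hacyclic : ∀ i, LinearMap.range (d (i + 1)) = LinearMap.ker (d i))
    (hmin : ∀ i, LinearMap.range (d i) ≤ maximalIdeal R • (⊤ : Submodule R (A i)))
    (n : ℕ) : ∀ i : ℤ, bet R (LinearMap.range (d i)) n =
    Module.finrank R (A (i + 1 + n)) := by
  induction n with
  | zero =>
    intro i
    rw [bet_zero (d i).rangeRestrict (d i).surjective_rangeRestrict (cover_ok A d hacyclic hmin i),
      show i + 1 + ((0 : ℕ) : ℤ) = i + 1 by simp]
  | succ n ih =>
    intro i
    rw [bet_succ (d i).rangeRestrict (d i).surjective_rangeRestrict (cover_ok A d hacyclic hmin i)]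
    have e : LinearMap.ker (d i).rangeRestrict = LinearMap.range (d (i+1)) := by
      rw [LinearMap.ker_rangeRestrict, ← hacyclic]
    rw [bet_congr (LinearEquiv.ofEq _ _ e), ih]
    have : i + 1 + 1 + (n:ℤ) = i + 1 + ((n+1 : ℕ) : ℤ) := by push_cast; ring
    rw [this]

theorem rank_pos
    (hacyclic : ∀ i, LinearMap.range (d (i + 1)) = LinearMap.ker (d i))
    (hmin : ∀ i, LinearMap.range (d i) ≤ maximalIdeal R • (⊤ : Submodule R (A i)))
    (i : ℤ) (h : 0 < Module.finrank R (A (i+1))) : 0 < Module.finrank R (A i) := by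
  by_contra h0
  have h0 : Module.finrank R (A i) = 0 := by omega
  have : len R (A i) = 0 := by rw [len_free, h0, mul_zero]
  rw [len_eq_zero] at this
  have h1 : LinearMap.ker (d i) = ⊤ := by
    rw [eq_top_iff]
    intro x _
    exact Subsingleton.elim _ _
  have h2 := hmin (i+1)
  rw [hacyclic, h1] at h2
  have := len_mono h2
  rw [len_top, len_free, len_free_smul, len_R] at this
  nlinarith

theorem rank_lt
    (hacyclic : ∀ i, LinearMap.range (d (i + 1)) = LinearMap.ker (d i))
    (hmin : ∀ i, LinearMap.range (d i) ≤ maximalIdeal R • (⊤ : Submodule R (A i)))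
    (h3 : maximalIdeal R ^ 3 = ⊥) (h2 : maximalIdeal R ^ 2 ≠ ⊥)
    (hlt : len R (maximalIdeal R ^ 2 : Ideal R) < len R (socle R)) (j : ℤ)
    (hpos : 0 < Module.finrank R (A (j+1))) :
    Module.finrank R (A (j+1)) < Module.finrank R (A (j+1+1)) := by
  by_contra hcon
  push Not at hcon
  set Z := LinearMap.range (d (j+1)) with hZ
  have h1 : socle R • (⊤ : Submodule R (A (j+1))) ≤ Z := by
    rw [hZ, hacyclic, Submodule.smul_le]
    intro s hs x _
    rw [LinearMap.mem_ker, map_smul]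
    have : s • d j x ∈ socle R • (maximalIdeal R • (⊤ : Submodule R (A j))) :=
      Submodule.smul_mem_smul hs (hmin j ⟨x, rfl⟩)
    rw [← Submodule.mul_smul, socle_mul, Submodule.bot_smul] at this
    exact this
  have h4 := len_mono h1
  have h5 := nu_add (R := R) (M := Z)
  have h6 := len_rad_le Z (hmin (j+1))
  have h7 := bet_range A d hacyclic hmin 0 (j+1)
  rw [show j + 1 + 1 + ((0 : ℕ) : ℤ) = j + 1 + 1 by simp] at h7
  rw [len_smul_top, h7] at h5
  have hsf := len_free_smul (R := R) (F := A (j+1)) (socle R)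
  have h8 : Z = socle R • (⊤ : Submodule R (A (j+1))) := by
    refine (eq_of_len h1 ?_).symm
    rw [hsf]
    nlinarith
  have h9 : maximalIdeal R • Z = ⊥ := by
    rw [h8, ← Submodule.mul_smul, mul_comm, socle_mul, Submodule.bot_smul]
  rw [h9, (len_sub_eq_zero _).2 rfl] at h5
  have h10 : 0 < len R (maximalIdeal R ^ 2 : Ideal R) :=
    Nat.pos_of_ne_zero fun h => h2 ((len_sub_eq_zero _).1 h)
  nlinarith

theorem socle_len
    (hacyclic : ∀ i, LinearMap.range (d (i + 1)) = LinearMap.ker (d i))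
    (hmin : ∀ i, LinearMap.range (d i) ≤ maximalIdeal R • (⊤ : Submodule R (A i)))
    (h3 : maximalIdeal R ^ 3 = ⊥) (h2 : maximalIdeal R ^ 2 ≠ ⊥) (i₀ : ℤ)
    (hpos : ∀ n : ℕ, 0 < Module.finrank R (A (i₀ - n))) :
    len R (maximalIdeal R ^ 2 : Ideal R) = len R (socle R) := by
  by_contra hne
  have hlt : len R (maximalIdeal R ^ 2 : Ideal R) < len R (socle R) :=
    lt_of_le_of_ne (len_mono (sq_le_socle h3)) hne
  have hs : ∀ n : ℕ, Module.finrank R (A (i₀ - (n+1 : ℕ))) < Module.finrank R (A (i₀ - n)) := by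
    intro n
    have := rank_lt A d hacyclic hmin h3 h2 hlt (i₀ - n - 2)
    rw [show i₀ - (n:ℤ) - 2 + 1 + 1 = i₀ - n by ring,
      show i₀ - (n:ℤ) - 2 + 1 = i₀ - (n+1 : ℕ) by push_cast; ring] at this
    exact this (hpos (n+1))
  have hb : ∀ n : ℕ, Module.finrank R (A (i₀ - n)) + n ≤ Module.finrank R (A (i₀ - (0 : ℕ))) := by
    intro n
    induction n with
    | zero => simp
    | succ n ih =>
      have := hs n
      omega
  have := hb (Module.finrank R (A (i₀ - (0:ℕ))) + 1)
  omega

theorem main_nat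
    (hacyclic : ∀ i, LinearMap.range (d (i + 1)) = LinearMap.ker (d i))
    (hmin : ∀ i, LinearMap.range (d i) ≤ maximalIdeal R • (⊤ : Submodule R (A i)))
    (h3 : maximalIdeal R ^ 3 = ⊥) (h2 : maximalIdeal R ^ 2 ≠ ⊥)
    (hr : 2 ≤ len R (socle R)) (i₀ : ℤ) (hi₀ : 0 < Module.finrank R (A i₀)) (n : ℕ) :
    bet R (ResidueField R) n = ∑ j ∈ Finset.range (n+1), len R (socle R) ^ j := by
  have hpos : ∀ n : ℕ, 0 < Module.finrank R (A (i₀ - n)) := by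
    intro n
    induction n with
    | zero => rwa [show i₀ - ((0 : ℕ) : ℤ) = i₀ by simp]
    | succ n ih =>
      apply rank_pos A d hacyclic hmin
      rwa [show i₀ - ((n+1 : ℕ) : ℤ) + 1 = i₀ - n by push_cast; ring]
  have hlen := socle_len A d hacyclic hmin h3 h2 i₀ hpos
  have hZ2 : ∀ i, maximalIdeal R ^ 2 • (⊤ : Submodule R (LinearMap.range (d i))) = ⊥ :=
    fun i => smul_top_bot _ _ (ker_facts h3 _ (hmin i))
  have hbet : ∀ n j : ℕ, j ≤ n → bet R (LinearMap.range (d (i₀ - n - 1))) j =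
      Module.finrank R (A (i₀ - (n - j : ℕ))) := by
    intro n j hj
    rw [bet_range A d hacyclic hmin]
    rw [show i₀ - (n:ℤ) - 1 + 1 + j = i₀ - (n - j : ℕ) by push_cast [hj]; ring]
  have hk2 : maximalIdeal R ^ 2 • (⊤ : Submodule R (ResidueField R)) = ⊥ := by
    rw [eq_bot_iff]
    refine le_trans (Submodule.smul_mono (Ideal.pow_le_self two_ne_zero) le_rfl) ?_
    exact hom_kills LinearMap.id
  refine numeric (fun n => Module.finrank R (A (i₀ - n))) (fun n => bet R (ResidueField R) n)
    (bet R (ResidueField R) 1) (len R (socle R)) hr hpos ?_ ?_ ?_ bet_k_zero rfl ?_ n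
  · intro n
    have := lemmaC h3 h2 (hlen ▸ hr) 0 _ (hZ2 (i₀ - (n+2 : ℕ) - 1))
    rw [hlen] at this
    rcases this with h | h | h
    · left
      rw [hbet _ _ (by omega), hbet _ _ (by omega), hbet _ _ (by omega)] at h
      exact h
    · right; left
      have := h (n+1)
      rw [hbet _ _ (by omega), show n + 2 - (0 + 1 + (n+1)) = 0 by omega] at this
      exact this
    · right; right
      have := h n
      rw [hbet _ _ (by omega), show n + 2 - (0 + 1 + 1 + n) = 0 by omega] at this
      exact this
  · intro n
    have := lemmaC h3 h2 (hlen ▸ hr) n _ hk2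
    rw [hlen] at this
    rcases this with h | h | h
    · exact Or.inl h
    · exact Or.inr ⟨n, h⟩
    · exact Or.inr ⟨n+1, h⟩
  · intro n
    have := rec_le (R := R) n (ResidueField R)
    rwa [hlen] at this
  · intro n j hj
    have h := rad_ineq (hZ2 (i₀ - n - 1)) j
    rw [hbet _ _ (by omega), hbet _ _ hj, len_smul_top] at h
    have h5 := len_rad_le _ (hmin (i₀ - n - 1))
    rw [hlen, show i₀ - (n:ℤ) - 1 = i₀ - (n+1 : ℕ) by push_cast; ring] at h5
    rw [show i₀ - (n:ℤ) - 1 = i₀ - (n+1 : ℕ) by push_cast; ring] at h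
    have h6 := Nat.mul_le_mul_right (bet R (ResidueField R) j) h5
    simp only [Nat.sub_zero] at h
    change Module.finrank R (A (i₀ - (n:ℕ))) * bet R (ResidueField R) (j+1) ≤
      Module.finrank R (A (i₀ - (n - j - 1 : ℕ))) +
        len R (socle R) * Module.finrank R (A (i₀ - (n+1 : ℕ))) * bet R (ResidueField R) j
    rw [show n - j - 1 = n - (j+1) by omega]
    omega

end Complex

end PS

/-- Theorem A(c): let `(R, m, k)` be a local ring with `m³ = 0 ≠ m²` which is not
Gorenstein (equivalently, `r ≥ 2`).  If there exists a non-zero minimal acyclic complex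
`A` (with differentials `d i : A (i+1) → A i`) of finitely generated free `R`-modules,
then `β_i^R(k) = ∑_{j=0}^{i} r^j` for all `i ≥ 0`, i.e. the Poincaré series of `k` is
`1/((1 − t)(1 − r·t))`. -/
theorem poincare_series (R : Type) [CommRing R] [IsNoetherianRing R] [IsLocalRing R]
    (h3 : maximalIdeal R ^ 3 = ⊥) (h2 : maximalIdeal R ^ 2 ≠ ⊥)
    (hnotGor : 2 ≤ socdim R)
    (A : ℤ → Type) [∀ i, AddCommGroup (A i)] [∀ i, Module R (A i)]
    (hfree : ∀ i, Module.Free R (A i)) (hfin : ∀ i, Module.Finite R (A i))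
    (d : ∀ i : ℤ, A (i + 1) →ₗ[R] A i)
    (hcx : ∀ i, d i ∘ₗ d (i + 1) = 0)
    (hacyclic : ∀ i, LinearMap.range (d (i + 1)) = LinearMap.ker (d i))
    (hmin : ∀ i, LinearMap.range (d i) ≤ maximalIdeal R • (⊤ : Submodule R (A i)))
    (hnz : ∃ i, Nontrivial (A i)) :
    ∀ i : ℕ, bettiNum R (ResidueField R) i = ∑ j ∈ Finset.range (i + 1), socdim R ^ j := by
  have : IsArtinianRing R :=
    (isArtinianRing_iff_isNilpotent_maximalIdeal R).2 ⟨3, h3⟩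
  have hsoc : socdim R = (PS.len R (socle R) : ℕ∞) := by
    rw [socdim, PS.moduleLength_eq, PS.coe_len]
  obtain ⟨i₀, hi₀⟩ := hnz
  have hpos : 0 < Module.finrank R (A i₀) := by
    rw [Module.finrank_eq_card_chooseBasisIndex]
    have : Nonempty (Module.Free.ChooseBasisIndex R (A i₀)) :=
      (Module.Free.chooseBasis R (A i₀)).index_nonempty
    exact Fintype.card_pos
  intro i
  rw [hsoc] at hnotGor ⊢
  rw [bettiNum, PS.moduleLength_eq, PS.bridge, ← PS.coe_bet,
    PS.main_nat A d hacyclic hmin h3 h2 (by exact_mod_cast hnotGor) i₀ hpos i]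
  push_cast
  rfl
end
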